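/- arXiv:2312.13922 — 3 statements merged into one kernel-verified Lean document; each statement's English description precedes it below -/
import Mathlib

section
/- Let n ≥ 1 and let K be a 1-symmetric convex body in ℝ^n. Then the function V_K(a) = (‖a‖₁/‖a‖₂)·vol_{n-1}(K ∩ a^⊥), defined for a ∈ ℝ^n \ {0}, is Schur concave on ℝ₊^n \ {0}: for all x, y ∈ ℝ₊^n \ {0} with x majorized by y, we have V_K(x) ≥ V_K(y). -/
open MeasureTheory Finset

/-- The (n-1)-dimensional Hausdorff measure of the central hyperplane section
`K ∩ a^⊥`. -/
noncomputable def sectVol (n : ℕ) (K : Set (EuclideanSpace ℝ (Fin n)))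
    (a : EuclideanSpace ℝ (Fin n)) : ℝ :=
  (Measure.hausdorffMeasure ((n : ℝ) - 1)
    (K ∩ {x : EuclideanSpace ℝ (Fin n) | inner ℝ x a = (0 : ℝ)})).toReal

/-- `V_K(a) = (‖a‖₁ / ‖a‖₂) · vol_{n-1}(K ∩ a^⊥)`. -/
noncomputable def VK (n : ℕ) (K : Set (EuclideanSpace ℝ (Fin n)))
    (a : EuclideanSpace ℝ (Fin n)) : ℝ :=
  ((∑ i, |a i|) / ‖a‖) * sectVol n K a

/-- `K` is 1-symmetric: symmetric about every coordinate hyperplane and invariant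
under permutations of the coordinates. -/
def IsOneSymmetric (n : ℕ) (K : Set (EuclideanSpace ℝ (Fin n))) : Prop :=
  (∀ j : Fin n, ∀ x ∈ K,
      (WithLp.toLp 2 (fun i => if i = j then -(x i) else x i) : EuclideanSpace ℝ (Fin n)) ∈ K) ∧
  ∀ σ : Equiv.Perm (Fin n), ∀ x ∈ K,
      (WithLp.toLp 2 (fun i => x (σ i)) : EuclideanSpace ℝ (Fin n)) ∈ K

/-- `x` is majorized by `y`: equal total sums, and (via nonincreasing rearrangements
realised by sorting permutations `σ`, `τ`) the partial sums of the `k` largest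
entries of `x` are at most those of `y` for every `k ≤ n - 1`. -/
def Majorized (n : ℕ) (x y : Fin n → ℝ) : Prop :=
  (∑ i, x i = ∑ i, y i) ∧
  ∃ σ τ : Equiv.Perm (Fin n),
    (∀ i j : Fin n, i ≤ j → x (σ j) ≤ x (σ i)) ∧
    (∀ i j : Fin n, i ≤ j → y (τ j) ≤ y (τ i)) ∧
    ∀ k : ℕ, k ≤ n - 1 →
      ∑ i ∈ univ.filter (fun i : Fin n => (i : ℕ) < k), x (σ i) ≤
        ∑ i ∈ univ.filter (fun i : Fin n => (i : ℕ) < k), y (τ i)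

/-- One-dimensional Brunn–Minkowski inequality for compact sets. -/
theorem Real.volume_add_volume_le_volume_add_of_isCompact {A B : Set ℝ}
    (hA : IsCompact A) (hB : IsCompact B) (hA' : A.Nonempty) (hB' : B.Nonempty) :
    volume A + volume B ≤ volume (Set.image2 (· + ·) A B) := by
  obtain ⟨a, haA, ha⟩ := hA.exists_isGreatest hA'
  obtain ⟨b, hbB, hb⟩ := hB.exists_isLeast hB'
  have hdisj : AEDisjoint volume ((· + b) '' A) ((a + ·) '' B) := by
    refine measure_mono_null (t := {a + b}) ?_ (by simp)
    rintro _ ⟨⟨x, hx, rfl⟩, ⟨y, hy, hxy⟩⟩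
    have h₁ : x ≤ a := ha hx
    have h₂ : b ≤ y := hb hy
    simp only at hxy
    simp only [Set.mem_singleton_iff]
    linarith
  have hm : NullMeasurableSet ((a + ·) '' B) volume :=
    (hB.image (by fun_prop)).measurableSet.nullMeasurableSet
  calc volume A + volume B = volume ((· + b) '' A) + volume ((a + ·) '' B) := by
        simp [Set.image_add_right, Set.image_add_left]
    _ = volume ((· + b) '' A ∪ (a + ·) '' B) := (measure_union₀ hm hdisj).symm
    _ ≤ _ := by
        refine measure_mono (Set.union_subset ?_ ?_)
        · rintro _ ⟨x, hx, rfl⟩; exact ⟨x, hx, b, hbB, rfl⟩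
        · rintro _ ⟨x, hx, rfl⟩; exact ⟨a, haA, x, hx, rfl⟩

/-- One-dimensional Brunn–Minkowski inequality for measurable sets. -/
theorem Real.volume_add_volume_le_volume_add {A B : Set ℝ}
    (hA : MeasurableSet A) (hB : MeasurableSet B) (hA' : A.Nonempty) (hB' : B.Nonempty) :
    volume A + volume B ≤ volume (Set.image2 (· + ·) A B) := by
  obtain ⟨a, ha⟩ := hA'
  obtain ⟨b, hb⟩ := hB'
  rw [hA.measure_eq_iSup_isCompact, hB.measure_eq_iSup_isCompact]
  simp only [iSup_and']
  refine ENNReal.biSup_add_biSup_le' (p := fun S : Set ℝ => S ⊆ A ∧ IsCompact S)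
    (q := fun S : Set ℝ => S ⊆ B ∧ IsCompact S)
    ⟨∅, Set.empty_subset _, isCompact_empty⟩ ⟨∅, Set.empty_subset _, isCompact_empty⟩ ?_
  rintro S ⟨hS, hSc⟩ T ⟨hT, hTc⟩
  calc volume S + volume T ≤ volume (insert a S) + volume (insert b T) := by
        gcongr <;> exact Set.subset_insert _ _
    _ ≤ _ := Real.volume_add_volume_le_volume_add_of_isCompact (hSc.insert a) (hTc.insert b)
        (Set.insert_nonempty _ _) (Set.insert_nonempty _ _)
    _ ≤ _ := measure_mono (Set.image2_subset (Set.insert_subset ha hS) (Set.insert_subset hb hT))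

/-- Weighted AM-GM inequality in `ℝ≥0∞`. -/
theorem ENNReal.rpow_mul_rpow_le_add {p q : ℝ} (hp : 0 < p) (hq : 0 < q) (hpq : p + q = 1)
    (a b : ENNReal) : a ^ p * b ^ q ≤ ENNReal.ofReal p * a + ENNReal.ofReal q * b := by
  have hp' : ENNReal.ofReal p ≠ 0 := by simpa using hp
  have hq' : ENNReal.ofReal q ≠ 0 := by simpa using hq
  rcases eq_or_ne a ⊤ with rfl | ha
  · simp [ENNReal.mul_top hp']
  rcases eq_or_ne b ⊤ with rfl | hb
  · simp [ENNReal.mul_top hq']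
  lift a to NNReal using ha
  lift b to NNReal using hb
  have h := NNReal.geom_mean_le_arith_mean2_weighted p.toNNReal q.toNNReal a b (by
    rw [← Real.toNNReal_add hp.le hq.le, hpq, Real.toNNReal_one])
  rw [Real.coe_toNNReal _ hp.le, Real.coe_toNNReal _ hq.le] at h
  rw [← ENNReal.coe_rpow_of_nonneg _ hp.le, ← ENNReal.coe_rpow_of_nonneg _ hq.le]
  simp only [ENNReal.ofReal]
  exact_mod_cast h

/-- Layer cake formula for an `ℝ≥0∞`-valued function bounded by one. -/
theorem MeasureTheory.lintegral_eq_setLIntegral_Ioo_meas_lt {α : Type*} [MeasurableSpace α]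
    {μ : Measure α} {f : α → ENNReal} (hf : Measurable f) (hf1 : ∀ x, f x ≤ 1) :
    ∫⁻ x, f x ∂μ = ∫⁻ t in Set.Ioo (0 : ℝ) 1, μ {x | ENNReal.ofReal t < f x} := by
  have hfin : ∀ x, f x ≠ ⊤ := fun x => ((hf1 x).trans_lt ENNReal.one_lt_top).ne
  have h := lintegral_eq_lintegral_meas_lt μ (f := fun x => (f x).toReal)
    (Filter.Eventually.of_forall fun x => ENNReal.toReal_nonneg) hf.ennreal_toReal.aemeasurable
  simp only [ENNReal.ofReal_toReal (hfin _)] at h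
  have hs : ∀ t : ℝ, 0 < t → {x | t < (f x).toReal} = {x | ENNReal.ofReal t < f x} := by
    intro t ht
    ext x
    simp only [Set.mem_ofPred_eq]
    rw [ENNReal.ofReal_lt_iff_lt_toReal ht.le (hfin x)]
  rw [h, setLIntegral_congr_fun measurableSet_Ioi (fun t ht => by rw [hs t ht]),
    ← Set.Ioo_union_Ici_eq_Ioi (zero_lt_one' ℝ),
    lintegral_union measurableSet_Ici (Set.disjoint_left.2 fun _ h h' => h.2.not_ge h')]
  convert add_zero _
  rw [setLIntegral_congr_fun (g := fun _ => 0) measurableSet_Ici, lintegral_zero]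
  intro t ht
  have : {x | ENNReal.ofReal t < f x} = ∅ := by
    ext x
    simp only [Set.mem_ofPred_eq, Set.mem_empty_iff_false, iff_false, not_lt]
    exact (hf1 x).trans (by simpa using ht)
  simp [this]

theorem lintegral_add_le_of_iSup_eq_one {p q : ℝ} (hp : 0 < p) (hq : 0 < q) (hpq : p + q = 1)
    {f g h : ℝ → ENNReal} (hf : Measurable f) (hg : Measurable g) (hh : Measurable h)
    (hf1 : ⨆ x, f x = 1) (hg1 : ⨆ x, g x = 1)
    (hfgh : ∀ x y, f x ^ p * g y ^ q ≤ h (p * x + q * y)) :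
    ENNReal.ofReal p * (∫⁻ x, f x) + ENNReal.ofReal q * (∫⁻ x, g x) ≤ ∫⁻ x, h x := by
  set h' : ℝ → ENNReal := fun x => min (h x) 1
  have hle : ∫⁻ x, h' x ≤ ∫⁻ x, h x := lintegral_mono fun x => min_le_left _ _
  refine le_trans ?_ hle
  have hf1' : ∀ x, f x ≤ 1 := fun x => hf1 ▸ le_iSup f x
  have hg1' : ∀ x, g x ≤ 1 := fun x => hg1 ▸ le_iSup g x
  rw [lintegral_eq_setLIntegral_Ioo_meas_lt hf hf1',
    lintegral_eq_setLIntegral_Ioo_meas_lt hg hg1',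
    lintegral_eq_setLIntegral_Ioo_meas_lt (hh.min measurable_const) (fun x => min_le_right _ _)]
  rw [← lintegral_const_mul' _ _ ENNReal.ofReal_ne_top,
    ← lintegral_const_mul' _ _ ENNReal.ofReal_ne_top]
  have hanti : ∀ u : ℝ → ENNReal, Antitone fun t : ℝ => volume {x | ENNReal.ofReal t < u x} := by
    intro u s t hst
    exact measure_mono fun x hx => (ENNReal.ofReal_le_ofReal hst).trans_lt hx
  rw [← lintegral_add_left ((hanti f).measurable.const_mul _)]
  refine setLIntegral_mono (hanti h').measurable fun t ht => ?_
  have ht1 : ENNReal.ofReal t < 1 := by simpa using ht.2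
  obtain ⟨x₀, hx₀⟩ := lt_iSup_iff.1 (hf1 ▸ ht1 : _ < ⨆ x, f x)
  obtain ⟨y₀, hy₀⟩ := lt_iSup_iff.1 (hg1 ▸ ht1 : _ < ⨆ x, g x)
  have hA : MeasurableSet {x | ENNReal.ofReal t < f x} := measurableSet_lt measurable_const hf
  have hB : MeasurableSet {x | ENNReal.ofReal t < g x} := measurableSet_lt measurable_const hg
  have hscale : ∀ {r : ℝ}, 0 < r → ∀ S : Set ℝ, volume ((fun x => r * x) '' S)
      = ENNReal.ofReal r * volume S := by
    intro r hr S
    have := Measure.addHaar_smul (volume : Measure ℝ) r S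
    rw [← Set.image_smul] at this
    simpa [abs_of_pos hr] using this
  rw [← hscale hp, ← hscale hq]
  have hme : ∀ {r : ℝ}, 0 < r → ∀ S : Set ℝ, MeasurableSet S →
      MeasurableSet ((fun x => r * x) '' S) := fun {r} hr S hS =>
    (measurableEmbedding_mulLeft₀ hr.ne').measurableSet_image.2 hS
  refine (Real.volume_add_volume_le_volume_add (hme hp _ hA) (hme hq _ hB)
    ⟨_, x₀, hx₀, rfl⟩ ⟨_, y₀, hy₀, rfl⟩).trans (measure_mono ?_)
  rintro _ ⟨_, ⟨x, hx, rfl⟩, _, ⟨y, hy, rfl⟩, rfl⟩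
  simp only [Set.mem_ofPred_eq, lt_min_iff] at hx hy ⊢
  refine ⟨lt_of_lt_of_le ?_ (hfgh x y), ht1⟩
  calc ENNReal.ofReal t = ENNReal.ofReal t ^ p * ENNReal.ofReal t ^ q := by
        rw [← ENNReal.rpow_add _ _ (by simpa using ht.1) ENNReal.ofReal_ne_top, hpq,
          ENNReal.rpow_one]
    _ < f x ^ p * g y ^ q :=
        ENNReal.mul_lt_mul (ENNReal.rpow_lt_rpow hx hp) (ENNReal.rpow_lt_rpow hy hq)

/-- One-dimensional Prékopa–Leindler inequality for bounded functions. -/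
theorem prekopaLeindler_real_of_iSup_ne_top {p q : ℝ} (hp : 0 < p) (hq : 0 < q) (hpq : p + q = 1)
    {f g h : ℝ → ENNReal} (hf : Measurable f) (hg : Measurable g) (hh : Measurable h)
    (hf1 : ⨆ x, f x ≠ ⊤) (hg1 : ⨆ x, g x ≠ ⊤)
    (hfgh : ∀ x y, f x ^ p * g y ^ q ≤ h (p * x + q * y)) :
    (∫⁻ x, f x) ^ p * (∫⁻ x, g x) ^ q ≤ ∫⁻ x, h x := by
  set M := ⨆ x, f x with hM
  set N := ⨆ x, g x with hN
  rcases eq_or_ne M 0 with hM0 | hM0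
  · have : f = 0 := funext fun x => by simpa using (ENNReal.iSup_eq_zero.1 hM0 x)
    simp [this, hp]
  rcases eq_or_ne N 0 with hN0 | hN0
  · have : g = 0 := funext fun x => by simpa using (ENNReal.iSup_eq_zero.1 hN0 x)
    simp [this, hq]
  have hMp : M ^ p ≠ 0 := by simp [ENNReal.rpow_eq_zero_iff, hM0, hp.not_gt]
  have hNq : N ^ q ≠ 0 := by simp [ENNReal.rpow_eq_zero_iff, hN0, hq.not_gt]
  have hMp' : M ^ p ≠ ⊤ := ENNReal.rpow_ne_top_of_nonneg hp.le hf1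
  have hNq' : N ^ q ≠ ⊤ := ENNReal.rpow_ne_top_of_nonneg hq.le hg1
  have key := lintegral_add_le_of_iSup_eq_one hp hq hpq (f := fun x => M⁻¹ * f x)
    (g := fun x => N⁻¹ * g x) (h := fun x => ((M ^ p)⁻¹ * (N ^ q)⁻¹) * h x)
    (hf.const_mul _) (hg.const_mul _) (hh.const_mul _)
    (by rw [← ENNReal.mul_iSup, ← hM, ENNReal.inv_mul_cancel hM0 hf1])
    (by rw [← ENNReal.mul_iSup, ← hN, ENNReal.inv_mul_cancel hN0 hg1])
    (fun x y => by
      rw [ENNReal.mul_rpow_of_nonneg _ _ hp.le, ENNReal.mul_rpow_of_nonneg _ _ hq.le,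
        ENNReal.inv_rpow, ENNReal.inv_rpow, mul_mul_mul_comm]
      gcongr
      exact hfgh x y)
  have key' := (ENNReal.rpow_mul_rpow_le_add hp hq hpq _ _).trans key
  rw [lintegral_const_mul _ hf, lintegral_const_mul _ hg, lintegral_const_mul _ hh,
    ENNReal.mul_rpow_of_nonneg _ _ hp.le, ENNReal.mul_rpow_of_nonneg _ _ hq.le,
    ENNReal.inv_rpow, ENNReal.inv_rpow, mul_mul_mul_comm] at key'
  have hc0 : (M ^ p)⁻¹ * (N ^ q)⁻¹ ≠ 0 := by
    simp [hMp', hNq']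
  have hct : (M ^ p)⁻¹ * (N ^ q)⁻¹ ≠ ⊤ :=
    ENNReal.mul_ne_top (ENNReal.inv_ne_top.2 hMp) (ENNReal.inv_ne_top.2 hNq)
  exact (ENNReal.mul_le_mul_iff_right hc0 hct).1 key'

/-- One-dimensional Prékopa–Leindler inequality. -/
theorem prekopaLeindler_real {p q : ℝ} (hp : 0 < p) (hq : 0 < q) (hpq : p + q = 1)
    {f g h : ℝ → ENNReal} (hf : Measurable f) (hg : Measurable g) (hh : Measurable h)
    (hfgh : ∀ x y, f x ^ p * g y ^ q ≤ h (p * x + q * y)) :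
    (∫⁻ x, f x) ^ p * (∫⁻ x, g x) ^ q ≤ ∫⁻ x, h x := by
  have htrunc : ∀ u : ℝ → ENNReal, Measurable u →
      Filter.Tendsto (fun n : ℕ => ∫⁻ x, min (u x) n) Filter.atTop (nhds (∫⁻ x, u x)) := by
    intro u hu
    refine lintegral_tendsto_of_tendsto_of_monotone
      (fun n => (hu.min measurable_const).aemeasurable)
      (Filter.Eventually.of_forall fun x i j hij => ?_) (Filter.Eventually.of_forall fun x => ?_)
    · exact min_le_min le_rfl (by exact_mod_cast hij)
    · simpa using (tendsto_const_nhds (x := u x)).min ENNReal.tendsto_nat_nhds_top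
  rcases eq_or_ne (∫⁻ x, f x) 0 with hf0 | hf0
  · simp [hf0, hp]
  rcases eq_or_ne (∫⁻ x, g x) 0 with hg0 | hg0
  · simp [hg0, hq]
  have hlim := ENNReal.Tendsto.mul
    ((ENNReal.continuous_rpow_const (y := p)).continuousAt.tendsto.comp (htrunc f hf))
    (Or.inl (by simp [ENNReal.rpow_eq_zero_iff, hf0, hp.not_gt]))
    ((ENNReal.continuous_rpow_const (y := q)).continuousAt.tendsto.comp (htrunc g hg))
    (Or.inl (by simp [ENNReal.rpow_eq_zero_iff, hg0, hq.not_gt]))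
  refine le_of_tendsto' hlim fun n => ?_
  refine prekopaLeindler_real_of_iSup_ne_top hp hq hpq (hf.min measurable_const)
    (hg.min measurable_const) hh ?_ ?_ fun x y => (hfgh x y).trans' ?_
  · exact ((iSup_le fun x => min_le_right _ _).trans_lt (ENNReal.natCast_lt_top n)).ne
  · exact ((iSup_le fun x => min_le_right _ _).trans_lt (ENNReal.natCast_lt_top n)).ne
  · gcongr <;> exact min_le_left _ _

theorem lintegral_fin_succ {m : ℕ} {f : (Fin (m + 1) → ℝ) → ENNReal} (hf : Measurable f) :
    ∫⁻ z, f z = ∫⁻ t, ∫⁻ z, f (Fin.cons t z) := by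
  have h := (volume_preserving_piFinSuccAbove (fun _ : Fin (m + 1) => ℝ) 0).symm
  rw [← h.lintegral_comp hf, Measure.volume_eq_prod,
    lintegral_prod _ (by fun_prop)]
  simp [MeasurableEquiv.piFinSuccAbove, Fin.insertNthEquiv]

/-- Prékopa–Leindler inequality. -/
theorem prekopaLeindler {p q : ℝ} (hp : 0 < p) (hq : 0 < q) (hpq : p + q = 1) {m : ℕ}
    {f g h : (Fin m → ℝ) → ENNReal} (hf : Measurable f) (hg : Measurable g) (hh : Measurable h)
    (hfgh : ∀ x y, f x ^ p * g y ^ q ≤ h (p • x + q • y)) :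
    (∫⁻ x, f x) ^ p * (∫⁻ x, g x) ^ q ≤ ∫⁻ x, h x := by
  induction m with
  | zero =>
    have h0 : ∀ u : (Fin 0 → ℝ) → ENNReal, ∫⁻ x, u x = u 0 := by
      intro u
      rw [volume_pi, Measure.pi_of_empty (x := 0)]
      simp
    rw [h0, h0, h0]
    simpa using hfgh 0 0
  | succ m ih =>
    have hc : Measurable fun z : ℝ × (Fin m → ℝ) => (Fin.cons z.1 z.2 : Fin (m + 1) → ℝ) := by
      refine measurable_pi_iff.2 fun i => ?_
      refine Fin.cases ?_ (fun j => ?_) i <;> simp <;> fun_prop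
    have hmarg : ∀ {u : (Fin (m + 1) → ℝ) → ENNReal}, Measurable u →
        Measurable fun t : ℝ => ∫⁻ z, u (Fin.cons t z) := fun hu =>
      Measurable.lintegral_prod_right' (hu.comp hc)
    rw [lintegral_fin_succ hf, lintegral_fin_succ hg, lintegral_fin_succ hh]
    refine prekopaLeindler_real hp hq hpq (hmarg hf) (hmarg hg) (hmarg hh) fun s t => ?_
    refine ih (hf.comp (hc.comp measurable_prodMk_left)) (hg.comp (hc.comp measurable_prodMk_left))
      (hh.comp (hc.comp measurable_prodMk_left)) fun x y => ?_
    convert hfgh (Fin.cons s x) (Fin.cons t y) using 2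
    ext i
    refine Fin.cases ?_ (fun j => ?_) i <;> simp

/-- Sections of a closed convex set by parallel affine subspaces, along a line about whose midpoint
the sections are symmetric, shrink away from the centre. -/
theorem volume_slice_le_of_abs_le {V : Type*} [NormedAddCommGroup V] [NormedSpace ℝ V]
    {K : Set V} (hK : IsClosed K) (hconv : Convex ℝ K) {m : ℕ} (b : Fin m → V) (u e : V)
    (hsymm : ∀ (r : ℝ) (z : Fin m → ℝ), u + r • e + ∑ i, z i • b i ∈ K →
      u + (-r) • e + ∑ i, (-z) i • b i ∈ K)
    {s t : ℝ} (hst : |t| ≤ |s|) :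
    volume {z : Fin m → ℝ | u + s • e + ∑ i, z i • b i ∈ K} ≤
      volume {z : Fin m → ℝ | u + t • e + ∑ i, z i • b i ∈ K} := by
  set S : ℝ → Set (Fin m → ℝ) := fun r => {z | u + r • e + ∑ i, z i • b i ∈ K} with hS
  have hmeas : ∀ r, MeasurableSet (S r) := fun r =>
    (hK.preimage (f := fun z : Fin m → ℝ => u + r • e + ∑ i, z i • b i)
      (by fun_prop)).measurableSet
  have hneg : ∀ r, volume (S (-r)) = volume (S r) := by
    intro r
    rw [← Measure.measure_neg]
    congr 1
    ext z
    refine ⟨fun hz => ?_, fun hz => hsymm r z hz⟩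
    have := hsymm (-r) (-z) hz
    rwa [neg_neg, neg_neg] at this
  change volume (S s) ≤ volume (S t)
  rcases eq_or_ne t s with rfl | h₁
  · rfl
  rcases eq_or_ne t (-s) with rfl | h₂
  · rw [hneg]
  have hs0 : 0 < |s| := by
    refine abs_pos.2 ?_
    rintro rfl
    simp at hst
    exact h₁ hst
  wlog hs : 0 < s generalizing s
  · have hs' : 0 < -s := by
      rcases lt_trichotomy s 0 with h | h | h
      · linarith
      · simp [h] at hs0
      · exact absurd h hs
    rw [← hneg s]
    exact this (by simpa using hst) h₂ (by simpa using h₁) (by simpa using hs0) hs'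
  rw [abs_of_pos hs, abs_le] at hst
  have ht₁ : t < s := lt_of_le_of_ne hst.2 h₁
  have ht₂ : -s < t := lt_of_le_of_ne hst.1 (Ne.symm h₂)
  have hp : 0 < (s + t) / (2 * s) := by apply div_pos <;> linarith
  have hq : 0 < (s - t) / (2 * s) := by apply div_pos <;> linarith
  have hpq : (s + t) / (2 * s) + (s - t) / (2 * s) = 1 := by field_simp; ring
  have htpq : (s + t) / (2 * s) * s + (s - t) / (2 * s) * (-s) = t := by field_simp; ring
  set p := (s + t) / (2 * s)
  set q := (s - t) / (2 * s)
  have key := prekopaLeindler hp hq hpq (f := (S s).indicator 1) (g := (S (-s)).indicator 1)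
    (h := (S t).indicator 1) (measurable_one.indicator (hmeas _))
    (measurable_one.indicator (hmeas _)) (measurable_one.indicator (hmeas _)) (fun x y => by
      by_cases hx : x ∈ S s
      · by_cases hy : y ∈ S (-s)
        · have hxy : p • x + q • y ∈ S t := by
            have := hconv hx hy hp.le hq.le hpq
            simp only [hS, Set.mem_ofPred_eq]
            convert this using 1
            have hu : u = p • u + q • u := by rw [← add_smul, hpq, one_smul]
            simp only [smul_add, Finset.smul_sum, smul_smul, Pi.add_apply, Pi.smul_apply,
              smul_eq_mul, add_smul, Finset.sum_add_distrib]
            nth_rewrite 1 [hu]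
            rw [← htpq, add_smul]
            abel
          simp [hx, hy, hxy]
        · simp [hy, hq]
      · simp [hx, hp])
  simp only [lintegral_indicator_one (hmeas _), hneg] at key
  rwa [← ENNReal.rpow_add_of_nonneg _ _ hp.le hq.le, hpq, ENNReal.rpow_one] at key

section HyperplaneSection

variable {n : ℕ}

/-- A central hyperplane section, in orthonormal coordinates of the hyperplane. -/
theorem exists_hausdorffMeasure_inter_hyperplane (k : ℕ) (hk : k + 1 = n) :
    ∃ C : NNReal, ∀ (d : Fin k → EuclideanSpace ℝ (Fin n)), Orthonormal ℝ d →
      ∀ a : EuclideanSpace ℝ (Fin n), a ≠ 0 → (∀ i, inner ℝ (d i) a = (0 : ℝ)) →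
      ∀ K : Set (EuclideanSpace ℝ (Fin n)), IsCompact K →
        Measure.hausdorffMeasure ((n : ℝ) - 1) (K ∩ {x | inner ℝ x a = (0 : ℝ)}) =
          C * volume {z : Fin k → ℝ | ∑ i, z i • d i ∈ K} ∧
        volume {z : Fin k → ℝ | ∑ i, z i • d i ∈ K} ≠ ⊤ := by
  have hexp : ((n : ℝ) - 1) = k := by rw [← hk]; push_cast; ring
  refine ⟨Measure.addHaarScalarFactor
    (Measure.hausdorffMeasure (k : ℝ) : Measure (EuclideanSpace ℝ (Fin k))) volume, ?_⟩
  intro d hd a ha hda K hK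
  set J : EuclideanSpace ℝ (Fin k) →ₗᵢ[ℝ] EuclideanSpace ℝ (Fin n) :=
    ((EuclideanSpace.basisFun (Fin k) ℝ).toBasis.constr ℝ d).isometryOfOrthonormal
      (v := (EuclideanSpace.basisFun (Fin k) ℝ).toBasis)
      (by simp [(EuclideanSpace.basisFun (Fin k) ℝ).orthonormal])
      (by
        have : ((EuclideanSpace.basisFun (Fin k) ℝ).toBasis.constr ℝ d) ∘
            (EuclideanSpace.basisFun (Fin k) ℝ).toBasis = d := by
          ext1 i
          simp only [Function.comp_apply, Module.Basis.constr_basis]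
        rwa [this])
  have hJ : ∀ z, J z = ∑ i, z i • d i := by
    intro z
    change ((EuclideanSpace.basisFun (Fin k) ℝ).toBasis.constr ℝ d) z = _
    simp [Module.Basis.constr_apply_fintype]
  have hrange : LinearMap.range J.toLinearMap = (ℝ ∙ a)ᗮ := by
    refine Submodule.eq_of_le_of_finrank_eq ?_ ?_
    · rintro _ ⟨z, rfl⟩
      rw [Submodule.mem_orthogonal_singleton_iff_inner_left]
      change inner ℝ (J z) a = 0
      simp [hJ, sum_inner, inner_smul_left, hda]
    · have h1 := LinearMap.finrank_range_of_inj (f := J.toLinearMap) J.injective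
      have h2 := Submodule.finrank_add_finrank_orthogonal (ℝ ∙ a)
      rw [finrank_span_singleton ha] at h2
      simp only [finrank_euclideanSpace, Fintype.card_fin] at h1 h2
      omega
  have hset : K ∩ {x | inner ℝ x a = (0 : ℝ)} = J '' (J ⁻¹' K) := by
    rw [Set.image_preimage_eq_inter_range]
    congr 1
    ext x
    have : x ∈ LinearMap.range J.toLinearMap ↔ x ∈ (ℝ ∙ a)ᗮ := by rw [hrange]
    rw [Submodule.mem_orthogonal_singleton_iff_inner_left] at this
    exact this.symm
  have hpre : volume (J ⁻¹' K) = volume {z : Fin k → ℝ | ∑ i, z i • d i ∈ K} := by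
    have hmp := PiLp.volume_preserving_toLp (Fin k)
    rw [← hmp.measure_preimage
      (hK.isClosed.preimage J.continuous).measurableSet.nullMeasurableSet]
    congr 1
    ext z
    simp [hJ]
  have hcpt : IsCompact (J ⁻¹' K) := J.isometry.isClosedEmbedding.isCompact_preimage hK
  refine ⟨?_, hpre ▸ hcpt.measure_lt_top.ne⟩
  rw [hset, hexp, J.isometry.hausdorffMeasure_image (Or.inl (by positivity)), ← hpre]
  exact congrArg (fun μ : Measure (EuclideanSpace ℝ (Fin k)) => μ (J ⁻¹' K))
    (Measure.isAddLeftInvariant_eq_smul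
      (Measure.hausdorffMeasure (k : ℝ) : Measure (EuclideanSpace ℝ (Fin k))) volume)

theorem volume_setOf_sum_cons_mem {V : Type*} [NormedAddCommGroup V] [NormedSpace ℝ V]
    {K : Set V} (hK : IsClosed K) {m : ℕ} (w : V) (b : Fin m → V) {r : ℝ} (hr : 0 < r) :
    volume {z : Fin (m + 1) → ℝ | ∑ i, z i • (Fin.cons w b : Fin (m + 1) → V) i ∈ K} =
      ENNReal.ofReal r *
        ∫⁻ t : ℝ, volume {z : Fin m → ℝ | t • r • w + ∑ i, z i • b i ∈ K} := by
  set S := {z : Fin (m + 1) → ℝ | ∑ i, z i • (Fin.cons w b : Fin (m + 1) → V) i ∈ K} with hS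
  have hmeas : MeasurableSet S :=
    (hK.preimage (f := fun z : Fin (m + 1) → ℝ =>
      ∑ i, z i • (Fin.cons w b : Fin (m + 1) → V) i) (by fun_prop)).measurableSet
  have hslice : ∀ t : ℝ, ∫⁻ z : Fin m → ℝ, S.indicator 1 (Fin.cons t z) =
      volume {z : Fin m → ℝ | t • w + ∑ i, z i • b i ∈ K} := by
    intro t
    have hm : MeasurableSet {z : Fin m → ℝ | t • w + ∑ i, z i • b i ∈ K} :=
      (hK.preimage (f := fun z : Fin m → ℝ => t • w + ∑ i, z i • b i) (by fun_prop)).measurableSet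
    rw [← lintegral_indicator_one hm]
    refine lintegral_congr fun z => ?_
    have : (Fin.cons t z : Fin (m + 1) → ℝ) ∈ S ↔ t • w + ∑ i, z i • b i ∈ K := by
      rw [hS, Set.mem_ofPred_eq, Fin.sum_univ_succ]
      simp
    simp only [Set.indicator, Set.mem_ofPred_eq]
    congr 1
    exact propext this
  rw [← lintegral_indicator_one hmeas, lintegral_fin_succ (measurable_one.indicator hmeas)]
  conv_lhs => rw [← Real.smul_map_volume_mul_left hr.ne']
  rw [lintegral_smul_measure, (measurableEmbedding_mulLeft₀ hr.ne').lintegral_map,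
    abs_of_pos hr, smul_eq_mul]
  simp only [hslice, smul_smul, mul_comm r]

theorem exists_orthonormal_cons_normal {V : Type*} [NormedAddCommGroup V] [InnerProductSpace ℝ V]
    {e v : V} (he : ‖e‖ = 1) (hv : ‖v‖ = 1) (hev : inner ℝ e v = (0 : ℝ)) {m : ℕ} {b : Fin m → V}
    (hbo : Orthonormal ℝ b) (hbe : ∀ i, inner ℝ (b i) e = (0 : ℝ))
    (hbv : ∀ i, inner ℝ (b i) v = (0 : ℝ)) (r : ℝ) {ρ : ℝ} (hρ : 0 < ρ) :
    ρ • e + r • v ≠ 0 ∧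
      (Orthonormal ℝ (Fin.cons (‖ρ • e + r • v‖⁻¹ • (ρ • v - r • e)) b : Fin (m + 1) → V) ∧
        ∀ i, inner ℝ ((Fin.cons (‖ρ • e + r • v‖⁻¹ • (ρ • v - r • e)) b : Fin (m + 1) → V) i)
          (ρ • e + r • v) = (0 : ℝ)) ∧
      (‖ρ • e + r • v‖ / ρ) • (‖ρ • e + r • v‖⁻¹ • (ρ • v - r • e)) = v - (r / ρ) • e := by
  have hve : inner ℝ v e = (0 : ℝ) := by rw [real_inner_comm, hev]
  have hee : inner ℝ e e = (1 : ℝ) := by rw [real_inner_self_eq_norm_sq, he]; norm_num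
  have hvv : inner ℝ v v = (1 : ℝ) := by rw [real_inner_self_eq_norm_sq, hv]; norm_num
  set a := ρ • e + r • v with ha
  have hinner : inner ℝ a e = ρ := by
    simp only [ha, inner_add_left, real_inner_smul_left, hee, hve]
    ring
  have ha0 : a ≠ 0 := by
    intro h
    rw [h, inner_zero_left] at hinner
    exact hρ.ne hinner
  have hnorm : 0 < ‖a‖ := norm_pos_iff.2 ha0
  have hnsq : ‖a‖ ^ 2 = ρ ^ 2 + r ^ 2 := by
    rw [← real_inner_self_eq_norm_sq]
    simp only [ha, inner_add_left, inner_add_right, real_inner_smul_left, real_inner_smul_right,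
      hee, hve, hev, hvv]
    ring
  set w := ‖a‖⁻¹ • (ρ • v - r • e) with hw
  have hwn : ‖w‖ = 1 := by
    have : ‖ρ • v - r • e‖ = ‖a‖ := by
      rw [← sq_eq_sq₀ (norm_nonneg _) (norm_nonneg _), hnsq, ← real_inner_self_eq_norm_sq]
      simp only [inner_sub_left, inner_sub_right, real_inner_smul_left, real_inner_smul_right,
        hee, hve, hev, hvv]
      ring
    rw [hw, norm_smul, this, norm_inv, norm_norm, inv_mul_cancel₀ hnorm.ne']
  have hbw : ∀ i, inner ℝ (b i) w = (0 : ℝ) := fun i => by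
    simp only [hw, inner_sub_right, real_inner_smul_right, hbe, hbv]
    ring
  refine ⟨ha0, ⟨⟨?_, ?_⟩, ?_⟩, ?_⟩
  · exact Fin.cases (by simpa using hwn) (fun i => by simpa using hbo.1 i)
  · intro i j hij
    induction i using Fin.cases with
    | zero =>
      induction j using Fin.cases with
      | zero => exact absurd rfl hij
      | succ j =>
        rw [Fin.cons_zero, Fin.cons_succ, real_inner_comm]
        exact hbw j
    | succ i =>
      induction j using Fin.cases with
      | zero =>
        rw [Fin.cons_zero, Fin.cons_succ]
        exact hbw i
      | succ j =>
        rw [Fin.cons_succ, Fin.cons_succ]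
        exact hbo.2 (fun h => hij (congrArg _ h))
  · refine Fin.cases ?_ fun i => ?_
    · simp only [Fin.cons_zero, hw, ha, inner_sub_left, inner_add_right, real_inner_smul_left,
        real_inner_smul_right, hee, hve, hev, hvv]
      ring
    · simp only [Fin.cons_succ, ha, inner_add_right, real_inner_smul_right, hbe, hbv]
      ring
  · rw [hw, smul_smul, smul_sub, smul_smul, smul_smul]
    congr 2
    · convert one_smul ℝ v using 2
      field_simp
    · field_simp

/-- For a compact convex set invariant under negation and under reflection in the hyperplane
orthogonal to `v`, tilting the normal vector of a central section towards `v` decreases the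
section, relative to the norm of the normal vector. -/
theorem hausdorffMeasure_section_mul_norm_le {K : Set (EuclideanSpace ℝ (Fin n))}
    (hK : IsCompact K) (hconv : Convex ℝ K) {e v : EuclideanSpace ℝ (Fin n)}
    (he : ‖e‖ = 1) (hv : ‖v‖ = 1) (hev : inner ℝ e v = (0 : ℝ))
    (hneg : ∀ x ∈ K, -x ∈ K) (hrefl : ∀ x ∈ K, x - (2 * inner ℝ x v) • v ∈ K)
    {ρ s t : ℝ} (hρ : 0 < ρ) (hst : |t| ≤ |s|) :
    (Measure.hausdorffMeasure ((n : ℝ) - 1)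
        (K ∩ {x | inner ℝ x (ρ • e + s • v) = (0 : ℝ)})).toReal * ‖ρ • e + t • v‖ ≤
      (Measure.hausdorffMeasure ((n : ℝ) - 1)
        (K ∩ {x | inner ℝ x (ρ • e + t • v) = (0 : ℝ)})).toReal * ‖ρ • e + s • v‖ := by
  have hve : inner ℝ v e = (0 : ℝ) := by rw [real_inner_comm, hev]
  have hpair : Orthonormal ℝ ![e, v] := by
    rw [orthonormal_iff_ite]
    intro i j
    fin_cases i <;> fin_cases j <;> simp [he, hv, hev, hve]
  set U := (Submodule.span ℝ (Set.range ![e, v]))ᗮ with hU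
  set m := Module.finrank ℝ U with hm
  have hmn : m + 1 + 1 = n := by
    have h1 := Submodule.finrank_add_finrank_orthogonal (Submodule.span ℝ (Set.range ![e, v]))
    rw [finrank_span_eq_card hpair.linearIndependent] at h1
    simp only [finrank_euclideanSpace, Fintype.card_fin] at h1
    rw [← hU, ← hm] at h1
    omega
  set b : Fin m → EuclideanSpace ℝ (Fin n) := fun i => stdOrthonormalBasis ℝ U i
  have hbo : Orthonormal ℝ b :=
    (stdOrthonormalBasis ℝ U).orthonormal.comp_linearIsometry U.subtypeₗᵢ
  have hmem : ∀ i, ∀ j, inner ℝ (b i) (![e, v] j) = (0 : ℝ) := fun i j => by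
    rw [real_inner_comm]
    exact (Submodule.mem_orthogonal _ _).1 (stdOrthonormalBasis ℝ U i).2 _
      (Submodule.subset_span ⟨j, rfl⟩)
  have hbe : ∀ i, inner ℝ (b i) e = (0 : ℝ) := fun i => hmem i 0
  have hbv : ∀ i, inner ℝ (b i) v = (0 : ℝ) := fun i => hmem i 1
  obtain ⟨C, hC⟩ := exists_hausdorffMeasure_inter_hyperplane (m + 1) hmn
  set I : ℝ → ENNReal := fun r => ∫⁻ β : ℝ,
    volume {z : Fin m → ℝ | β • v + (-(β * (r / ρ))) • e + ∑ i, z i • b i ∈ K}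
  have hI_mono : I s ≤ I t := by
    refine lintegral_mono fun β => ?_
    refine volume_slice_le_of_abs_le hK.isClosed hconv b (β • v) e (fun r z hz => ?_) ?_
    · have := hneg _ (hrefl _ hz)
      convert this using 1
      have hin : inner ℝ (β • v + r • e + ∑ i, z i • b i) v = β := by
        simp [inner_add_left, inner_smul_left, sum_inner, hbv, hev, hv]
      rw [hin]
      simp only [Pi.neg_apply, neg_smul, Finset.sum_neg_distrib]
      module
    · simp only [abs_neg, abs_mul, abs_div]
      gcongr
  have hform : ∀ r : ℝ, ∃ L : ENNReal, L ≠ ⊤ ∧ L = ENNReal.ofReal (‖ρ • e + r • v‖ / ρ) * I r ∧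
      Measure.hausdorffMeasure ((n : ℝ) - 1)
        (K ∩ {x | inner ℝ x (ρ • e + r • v) = (0 : ℝ)}) = C * L := by
    intro r
    obtain ⟨h1, h2, h3⟩ := exists_orthonormal_cons_normal he hv hev hbo hbe hbv r hρ
    obtain ⟨h4, h5⟩ := hC _ h2.1 (ρ • e + r • v) h1 h2.2 K hK
    refine ⟨_, h5, ?_, h4⟩
    rw [volume_setOf_sum_cons_mem hK.isClosed _ b
      (div_pos (norm_pos_iff.2 h1) hρ), h3]
    congr 1
    refine lintegral_congr fun β => ?_
    congr! 5
    module
  obtain ⟨L, hL, hLI, hLs⟩ := hform s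
  obtain ⟨M, hM, hMI, hMt⟩ := hform t
  have hle : L * ENNReal.ofReal (‖ρ • e + t • v‖ / ρ) ≤
      M * ENNReal.ofReal (‖ρ • e + s • v‖ / ρ) := by
    rw [hLI, hMI, mul_right_comm, mul_right_comm (ENNReal.ofReal _) (I t),
      mul_comm (ENNReal.ofReal (‖ρ • e + t • v‖ / ρ))]
    gcongr
  have hle' := ENNReal.toReal_mono (ENNReal.mul_ne_top hM ENNReal.ofReal_ne_top) hle
  rw [ENNReal.toReal_mul, ENNReal.toReal_mul, ENNReal.toReal_ofReal (by positivity),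
    ENNReal.toReal_ofReal (by positivity), ← mul_div_assoc, ← mul_div_assoc,
    div_le_div_iff_of_pos_right hρ] at hle'
  rw [hLs, hMt, ENNReal.toReal_mul, ENNReal.toReal_mul, mul_assoc, mul_assoc]
  exact mul_le_mul_of_nonneg_left hle' ENNReal.toReal_nonneg

end HyperplaneSection

/-- A function on nonnegative vectors which increases under transfers from a larger to a smaller
coordinate is decreasing in the majorization order. -/
theorem le_of_forall_transfer_of_sum_le {n : ℕ} (F : (Fin n → ℝ) → ℝ)
    (hF : ∀ (y : Fin n → ℝ) (i j : Fin n) (δ : ℝ), (∀ l, 0 ≤ y l) → 0 < ∑ l, y l → i ≠ j → 0 ≤ δ →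
      δ ≤ y i - y j → F y ≤ F (y + Pi.single j δ - Pi.single i δ))
    (x y : Fin n → ℝ) (hx : Antitone x) (hx0 : ∀ l, 0 ≤ x l) (hy0 : ∀ l, 0 ≤ y l)
    (hpos : 0 < ∑ l, x l) (hsum : ∑ l, x l = ∑ l, y l)
    (hle : ∀ k : ℕ, ∑ l ∈ univ.filter (fun l : Fin n => (l : ℕ) < k), x l ≤
      ∑ l ∈ univ.filter (fun l : Fin n => (l : ℕ) < k), y l) :
    F y ≤ F x := by
  induction hN : (univ.filter fun l => x l ≠ y l).card using Nat.strong_induction_on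
    generalizing y with
  | _ N ih =>
  by_cases hxy : x = y
  · rw [hxy]
  have hex : ∃ j, y j < x j := by
    by_contra! h
    exact hxy (funext fun l => (Finset.sum_eq_sum_iff_of_le fun i _ => h i).1 hsum l (mem_univ l))
  set J := univ.filter fun l => y l < x l with hJ
  have hJne : J.Nonempty := by
    obtain ⟨j, hj⟩ := hex
    exact ⟨j, by simpa [hJ] using hj⟩
  set j := J.min' hJne with hj
  have hjx : y j < x j := by simpa [hJ] using J.min'_mem hJne
  have hbefore : ∀ l < j, x l ≤ y l := by
    intro l hl
    by_contra! h
    exact absurd (J.min'_le l (by simpa [hJ] using h)) (not_le.2 hl)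
  obtain ⟨i, hij, hix⟩ : ∃ i < j, x i < y i := by
    by_contra! h
    have hlt : ∑ l ∈ univ.filter (fun l : Fin n => (l : ℕ) < j + 1), y l <
        ∑ l ∈ univ.filter (fun l : Fin n => (l : ℕ) < j + 1), x l := by
      refine Finset.sum_lt_sum (fun l hl => ?_) ⟨j, by simp, hjx⟩
      rcases lt_or_eq_of_le (show l ≤ j by simp at hl; exact Fin.le_def.2 (by omega)) with hl | rfl
      · exact h l hl
      · exact hjx.le
    exact absurd (hle (j + 1)) (not_le.2 hlt)
  have hij' : i ≠ j := hij.ne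
  set δ := min (y i - x i) (x j - y j) with hδ
  have hδ0 : 0 < δ := lt_min (by linarith) (by linarith)
  have hδi : δ ≤ y i - x i := min_le_left _ _
  have hδj : δ ≤ x j - y j := min_le_right _ _
  have hxij : x j ≤ x i := hx hij.le
  refine (hF y i j δ hy0 (hsum ▸ hpos) hij' hδ0.le (by linarith)).trans ?_
  set y' := y + Pi.single j δ - Pi.single i δ with hy'
  have hy'i : y' i = y i - δ := by simp [hy', hij']
  have hy'j : y' j = y j + δ := by simp [hy', hij'.symm]
  have hy'l : ∀ l, l ≠ i → l ≠ j → y' l = y l := fun l h₁ h₂ => by simp [hy', h₁, h₂]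
  have hsum' : ∀ s : Finset (Fin n), ∑ l ∈ s, y' l =
      ∑ l ∈ s, y l + (if j ∈ s then δ else 0) - (if i ∈ s then δ else 0) := fun s => by
    simp [hy', Finset.sum_add_distrib, Finset.sum_sub_distrib, Finset.sum_pi_single']
  refine ih _ ?_ y' ?_ ?_ ?_ rfl
  · rw [← hN]
    refine Finset.card_lt_card ⟨fun l hl => ?_, fun hsub => ?_⟩
    · simp only [Finset.mem_filter, Finset.mem_univ, true_and] at hl ⊢
      rcases eq_or_ne l i with rfl | h₁
      · exact hix.ne
      rcases eq_or_ne l j with rfl | h₂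
      · exact hjx.ne'
      rwa [hy'l l h₁ h₂] at hl
    · have hi := hsub (show i ∈ _ by simpa using hix.ne)
      have hj' := hsub (show j ∈ _ by simpa using hjx.ne')
      simp only [Finset.mem_filter, Finset.mem_univ, true_and, hy'i, hy'j] at hi hj'
      rcases min_choice (y i - x i) (x j - y j) with h | h
      · rw [← hδ] at h
        exact hi (by linarith)
      · rw [← hδ] at h
        exact hj' (by linarith)
  · intro l
    rcases eq_or_ne l i with rfl | h₁
    · rw [hy'i]; linarith [hx0 l]
    rcases eq_or_ne l j with rfl | h₂
    · rw [hy'j]; linarith [hy0 j]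
    rw [hy'l l h₁ h₂]; exact hy0 l
  · rw [hsum', ← hsum]; simp
  · intro k
    rw [hsum']
    simp only [Finset.mem_filter, Finset.mem_univ, true_and]
    by_cases hik : (i : ℕ) < k
    · by_cases hjk : (j : ℕ) < k
      · simpa [hik, hjk] using hle k
      · simp only [hik, hjk, if_true, if_false, add_zero]
        have hlj : ∀ l ∈ univ.filter (fun l : Fin n => (l : ℕ) < k), 0 ≤ y l - x l := by
          intro l hl
          simp only [Finset.mem_filter, Finset.mem_univ, true_and] at hl
          exact sub_nonneg.2 (hbefore l (Fin.lt_def.2 (by omega)))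
        have := Finset.single_le_sum hlj (show i ∈ _ by simpa using hik)
        rw [Finset.sum_sub_distrib] at this
        linarith
    · have hjk : ¬ (j : ℕ) < k := by have := Fin.lt_def.1 hij; omega
      simpa [hik, hjk] using hle k

theorem IsOneSymmetric.neg_mem {n : ℕ} {K : Set (EuclideanSpace ℝ (Fin n))}
    (hK : IsOneSymmetric n K) {x : EuclideanSpace ℝ (Fin n)} (hx : x ∈ K) : -x ∈ K := by
  have h : ∀ s : Finset (Fin n),
      (WithLp.toLp 2 (fun i => if i ∈ s then -(x i) else x i) : EuclideanSpace ℝ (Fin n)) ∈ K := by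
    intro s
    induction s using Finset.induction_on with
    | empty => simpa using hx
    | insert j s hj ih =>
      convert hK.1 j _ ih using 2
      ext i
      by_cases hij : i = j
      · subst hij; simp [hj]
      · simp [hij]
  convert h univ using 1
  ext i
  simp

/-- `V_K` is invariant under permutations of the coordinates. -/
theorem VK_comp_perm {n : ℕ} {K : Set (EuclideanSpace ℝ (Fin n))}
    (hK : IsOneSymmetric n K) (a : EuclideanSpace ℝ (Fin n)) (σ : Equiv.Perm (Fin n)) :
    VK n K (WithLp.toLp 2 (fun i => a (σ i))) = VK n K a := by
  set E := LinearIsometryEquiv.piLpCongrLeft 2 ℝ ℝ σ.symm with hE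
  have hEa : ∀ x : EuclideanSpace ℝ (Fin n), E x = WithLp.toLp 2 (fun i => x (σ i)) := by
    intro x
    ext i
    simp [hE, LinearIsometryEquiv.piLpCongrLeft_apply, Equiv.piCongrLeft'_apply]
  have hEs : ∀ x : EuclideanSpace ℝ (Fin n),
      E.symm x = WithLp.toLp 2 (fun i => x (σ.symm i)) := by
    intro x
    rw [LinearIsometryEquiv.symm_apply_eq, hEa]
    simp
  rw [← hEa]
  have hset : K ∩ {x | inner ℝ x (E a) = (0 : ℝ)} =
      E.toIsometryEquiv '' (K ∩ {x | inner ℝ x a = (0 : ℝ)}) := by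
    ext x
    constructor
    · rintro ⟨hxK, hxa⟩
      refine ⟨E.symm x, ⟨?_, ?_⟩, by simp⟩
      · rw [hEs]; exact hK.2 _ _ hxK
      · rw [Set.mem_ofPred_eq, ← E.inner_map_map, E.apply_symm_apply]
        exact hxa
    · rintro ⟨z, ⟨hzK, hza⟩, rfl⟩
      refine ⟨?_, ?_⟩
      · change E z ∈ K
        rw [hEa]; exact hK.2 _ _ hzK
      · change inner ℝ (E z) (E a) = 0
        rw [E.inner_map_map]; exact hza
  have hsum : ∑ i, |E a i| = ∑ i, |a i| := by
    rw [hEa]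
    exact Equiv.sum_comp σ (fun i => |a i|)
  rw [VK, VK, sectVol, sectVol, hset, IsometryEquiv.hausdorffMeasure_image, E.norm_map, hsum]

/-- `V_K` increases under transfers from a larger to a smaller coordinate. -/
theorem VK_le_VK_transfer {n : ℕ} {K : Set (EuclideanSpace ℝ (Fin n))}
    (hcpt : IsCompact K) (hconv : Convex ℝ K) (hK : IsOneSymmetric n K)
    (y : Fin n → ℝ) (i j : Fin n) (δ : ℝ) (hy0 : ∀ l, 0 ≤ y l) (hpos : 0 < ∑ l, y l) (hij : i ≠ j)
    (hδ0 : 0 ≤ δ) (hδ : δ ≤ y i - y j) :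
    VK n K (WithLp.toLp 2 y) ≤ VK n K (WithLp.toLp 2 (y + Pi.single j δ - Pi.single i δ)) := by
  set κ : ℝ := (√2)⁻¹ with hκ
  have hκ0 : 0 < κ := by positivity
  have hκ2 : κ * κ = 1 / 2 := by
    rw [hκ, ← mul_inv, Real.mul_self_sqrt (by norm_num)]; norm_num
  set v : EuclideanSpace ℝ (Fin n) :=
    WithLp.toLp 2 (Pi.single i κ - Pi.single j κ) with hv
  have hinner : ∀ x : EuclideanSpace ℝ (Fin n), inner ℝ x v = κ * (x i - x j) := by
    intro x
    simp only [PiLp.inner_apply, hv, Pi.sub_apply, inner_sub_right, Finset.sum_sub_distrib]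
    simp [Pi.single_apply, mul_sub]
  have hvi : v i = κ := by simp [hv, hij]
  have hvj : v j = -κ := by simp [hv, hij.symm]
  have hvl : ∀ l, l ≠ i → l ≠ j → v l = 0 := fun l h₁ h₂ => by simp [hv, h₁, h₂]
  have hvv : inner ℝ v v = (1 : ℝ) := by
    rw [hinner, hvi, hvj]; linarith
  have hvn : ‖v‖ = 1 := by
    rw [← sq_eq_sq₀ (norm_nonneg _) zero_le_one, ← real_inner_self_eq_norm_sq, hvv]; norm_num
  have hvsum : ∑ l, v l = 0 := by
    simp [hv, Finset.sum_sub_distrib]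
  set Y : EuclideanSpace ℝ (Fin n) := WithLp.toLp 2 y with hY
  set y' := y + Pi.single j δ - Pi.single i δ with hy'
  set Y' : EuclideanSpace ℝ (Fin n) := WithLp.toLp 2 y' with hY'
  have hy'i : y' i = y i - δ := by simp [hy', hij]
  have hy'j : y' j = y j + δ := by simp [hy', hij.symm]
  have hy'l : ∀ l, l ≠ i → l ≠ j → y' l = y l := fun l h₁ h₂ => by simp [hy', h₁, h₂]
  set s : ℝ := κ * (y i - y j) with hs
  set t : ℝ := κ * (y i - y j - 2 * δ) with ht
  set c := Y - s • v with hc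
  have hcv : inner ℝ c v = (0 : ℝ) := by
    rw [hc, inner_sub_left, real_inner_smul_left, hvv, hinner]
    simp [hY, hs]
  have hc0 : c ≠ 0 := by
    intro h
    have hYs : Y = s • v := sub_eq_zero.1 h
    have : ∑ l, Y l = 0 := by
      rw [hYs]; simp [← Finset.mul_sum, hvsum]
    exact hpos.ne' this
  have hρ : 0 < ‖c‖ := norm_pos_iff.2 hc0
  have hce : ‖c‖ • (‖c‖⁻¹ • c) = c := by rw [smul_smul, mul_inv_cancel₀ hρ.ne', one_smul]
  have hYe : Y = ‖c‖ • (‖c‖⁻¹ • c) + s • v := by rw [hce, hc]; abel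
  have hYe' : Y' = ‖c‖ • (‖c‖⁻¹ • c) + t • v := by
    rw [hce, hc]
    ext l
    simp only [PiLp.add_apply, PiLp.sub_apply, PiLp.smul_apply, smul_eq_mul, hY, hY']
    rcases eq_or_ne l i with rfl | h₁
    · rw [hy'i, hvi]; linear_combination (2 * δ) * hκ2
    rcases eq_or_ne l j with rfl | h₂
    · rw [hy'j, hvj]; linear_combination (-2 * δ) * hκ2
    rw [hy'l l h₁ h₂, hvl l h₁ h₂]; ring
  have hst : |t| ≤ |s| := by
    rw [hs, ht, abs_mul, abs_mul]
    refine mul_le_mul_of_nonneg_left ?_ (abs_nonneg _)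
    rw [abs_of_nonneg (show 0 ≤ y i - y j by linarith), abs_le]
    constructor <;> linarith
  have key := hausdorffMeasure_section_mul_norm_le hcpt hconv (e := ‖c‖⁻¹ • c) (v := v)
    (by rw [norm_smul, norm_inv, norm_norm, inv_mul_cancel₀ hρ.ne']) hvn
    (by rw [real_inner_smul_left, hcv, mul_zero]) (fun x hx => hK.neg_mem hx)
    (fun x hx => by
      convert hK.2 (Equiv.swap i j) x hx using 1
      ext l
      rw [hinner]
      simp only [PiLp.sub_apply, PiLp.smul_apply, smul_eq_mul]
      rcases eq_or_ne l i with rfl | h₁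
      · rw [hvi, Equiv.swap_apply_left]; linear_combination (-2 * (x l - x j)) * hκ2
      rcases eq_or_ne l j with rfl | h₂
      · rw [hvj, Equiv.swap_apply_right]; linear_combination (2 * (x i - x l)) * hκ2
      rw [hvl l h₁ h₂, Equiv.swap_apply_of_ne_of_ne h₁ h₂]; ring) hρ hst
  rw [← hYe, ← hYe'] at key
  have hy'0 : ∀ l, 0 ≤ y' l := by
    intro l
    rcases eq_or_ne l i with rfl | h₁
    · rw [hy'i]; linarith [hy0 j]
    rcases eq_or_ne l j with rfl | h₂
    · rw [hy'j]; linarith [hy0 l]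
    rw [hy'l l h₁ h₂]; exact hy0 l
  have hsum : ∑ l, y' l = ∑ l, y l := by
    simp [hy', Finset.sum_add_distrib, Finset.sum_sub_distrib]
  have habs : ∑ l, |Y l| = ∑ l, y l := Finset.sum_congr rfl fun l _ => abs_of_nonneg (hy0 l)
  have habs' : ∑ l, |Y' l| = ∑ l, y l :=
    (Finset.sum_congr rfl fun l _ => abs_of_nonneg (hy'0 l)).trans hsum
  have hYn : 0 < ‖Y‖ := norm_pos_iff.2 fun h => hpos.ne' (by
    change ∑ l, Y l = 0
    simp [h])
  have hYn' : 0 < ‖Y'‖ := norm_pos_iff.2 fun h => (hsum ▸ hpos : 0 < ∑ l, y' l).ne' (by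
    change ∑ l, Y' l = 0
    simp [h])
  rw [VK, VK, habs, habs', div_mul_eq_mul_div, div_mul_eq_mul_div, div_le_div_iff₀ hYn hYn',
    mul_assoc, mul_assoc]
  exact mul_le_mul_of_nonneg_left key hpos.le

theorem schur_concavity_of_VK (n : ℕ) (hn : 1 ≤ n)
    (K : Set (EuclideanSpace ℝ (Fin n)))
    (hK_cpt : IsCompact K) (hK_conv : Convex ℝ K)
    (hK_int : (interior K).Nonempty) (hK_sym : IsOneSymmetric n K)
    (x y : EuclideanSpace ℝ (Fin n))
    (hx_nonneg : ∀ i, 0 ≤ x i) (hy_nonneg : ∀ i, 0 ≤ y i)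
    (hx0 : x ≠ 0) (hy0 : y ≠ 0)
    (hmaj : Majorized n (fun i => x i) (fun i => y i)) :
    VK n K y ≤ VK n K x := by
  obtain ⟨hsum, σ, τ, hσ, hτ, hle⟩ := hmaj
  have hpos : 0 < ∑ l, x l := by
    refine (Finset.sum_nonneg fun l _ => hx_nonneg l).lt_of_ne' fun h => hx0 ?_
    ext l
    exact (Finset.sum_eq_zero_iff_of_nonneg fun l _ => hx_nonneg l).1 h l (mem_univ l)
  have hsum' : ∑ l, x (σ l) = ∑ l, y (τ l) := by
    rw [Equiv.sum_comp σ (fun l => x l), Equiv.sum_comp τ (fun l => y l)]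
    exact hsum
  rw [← VK_comp_perm hK_sym x σ, ← VK_comp_perm hK_sym y τ]
  refine le_of_forall_transfer_of_sum_le (fun a => VK n K (WithLp.toLp 2 a))
    (fun a => VK_le_VK_transfer hK_cpt hK_conv hK_sym a) (fun l => x (σ l)) (fun l => y (τ l))
    (fun i j h => hσ i j h) (fun l => hx_nonneg _) (fun l => hy_nonneg _)
    (by rwa [Equiv.sum_comp σ (fun l => x l)]) hsum' fun k => ?_
  rcases le_or_gt k (n - 1) with hk | hk
  · exact hle k hk
  · have : univ.filter (fun l : Fin n => (l : ℕ) < k) = univ :=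
      Finset.filter_true_of_mem fun l _ => by omega
    rw [this]
    exact hsum'.le
end

section
/- (Busemann's theorem) Let K be an origin-symmetric convex body in ℝ^n. Then the function N_K(x) = ‖x‖₂ / vol_{n-1}(K ∩ x^⊥) for x ≠ 0, extended by N_K(0) = 0, defines a norm on ℝ^n; that is, N_K is positively homogeneous, symmetric, vanishes only at 0, and satisfies the triangle inequality N_K(x+y) ≤ N_K(x) + N_K(y) for all x, y ∈ ℝ^n. -/
open MeasureTheory Finset
open scoped Classical

/-- Busemann's function `N_K(x) = ‖x‖₂ / vol_{n-1}(K ∩ x^⊥)`, with `N_K(0) = 0`. -/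

noncomputable def NK (n : ℕ) (K : Set (EuclideanSpace ℝ (Fin n)))
    (x : EuclideanSpace ℝ (Fin n)) : ℝ :=
  if x = 0 then 0 else ‖x‖ / sectVol n K x

open Set Pointwise in
/-- The one-dimensional Brunn–Minkowski inequality for compact sets. -/
lemma volume_add_volume_le_of_isCompact {A B : Set ℝ} (hA : IsCompact A) (hB : IsCompact B)
    (hA' : A.Nonempty) (hB' : B.Nonempty) : volume A + volume B ≤ volume (A + B) := by
  obtain ⟨a, ha⟩ := hA.exists_isGreatest hA'
  obtain ⟨b, hb⟩ := hB.exists_isLeast hB'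
  have h1 : volume ((fun x => x + b) '' A) = volume A := by simp
  have h2 : volume ((fun x => a + x) '' B) = volume B := by simp
  have hd : AEDisjoint volume ((fun x => x + b) '' A) ((fun x => a + x) '' B) := by
    refine measure_mono_null (t := {a + b}) ?_ (by simp)
    rintro _ ⟨⟨x, hx, rfl⟩, ⟨y, hy, hxy⟩⟩
    have := ha.2 hx
    have := hb.2 hy
    simp only [mem_singleton_iff] at *
    linarith
  have hm : NullMeasurableSet ((fun x => a + x) '' B) :=
    (hB.image (by fun_prop)).measurableSet.nullMeasurableSet
  rw [← h1, ← h2, ← measure_union₀ hm hd]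
  apply measure_mono
  rintro _ (⟨x, hx, rfl⟩ | ⟨x, hx, rfl⟩)
  · exact add_mem_add hx hb.1
  · exact add_mem_add ha.1 hx

open Set Pointwise in
/-- The one-dimensional Brunn–Minkowski inequality for open sets. -/
lemma volume_add_volume_le_of_isOpen {A B : Set ℝ} (hA : IsOpen A) (hB : IsOpen B)
    (hA' : A.Nonempty) (hB' : B.Nonempty) : volume A + volume B ≤ volume (A + B) := by
  obtain ⟨a, ha⟩ := hA'
  obtain ⟨b, hb⟩ := hB'
  rw [hA.measure_eq_iSup_isCompact, hB.measure_eq_iSup_isCompact]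
  simp only [iSup_and']
  refine ENNReal.biSup_add_biSup_le' (p := fun K : Set ℝ => K ⊆ A ∧ IsCompact K)
    (q := fun K : Set ℝ => K ⊆ B ∧ IsCompact K) ⟨∅, by simp⟩ ⟨∅, by simp⟩ ?_
  rintro K ⟨hKA, hK⟩ L ⟨hLB, hL⟩
  calc volume K + volume L ≤ volume (insert a K) + volume (insert b L) := by
        gcongr <;> exact subset_insert _ _
    _ ≤ volume (insert a K + insert b L) :=
        volume_add_volume_le_of_isCompact (hK.insert a) (hL.insert b) (by simp) (by simp)
    _ ≤ volume (A + B) := by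
        apply measure_mono
        exact add_subset_add (insert_subset ha hKA) (insert_subset hb hLB)

/-- A one-dimensional Prékopa–Leindler type inequality for functions with equal suprema. -/
lemma lintegral_add_lintegral_le_of_min_le {f g h : ℝ → ℝ} (hf : Continuous f)
    (hg : Continuous g) (hh : Measurable h) (hf0 : 0 ≤ f) (hg0 : 0 ≤ g) (hh0 : 0 ≤ h)
    (hfg : ∀ t, (∃ z, t < f z) ↔ ∃ w, t < g w) (hmin : ∀ z w, min (f z) (g w) ≤ h (z + w)) :
    (∫⁻ z, ENNReal.ofReal (f z)) + ∫⁻ z, ENNReal.ofReal (g z) ≤ ∫⁻ z, ENNReal.ofReal (h z) := by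
  rw [lintegral_eq_lintegral_meas_lt _ (ae_of_all _ hf0) hf.aemeasurable,
    lintegral_eq_lintegral_meas_lt _ (ae_of_all _ hg0) hg.aemeasurable,
    lintegral_eq_lintegral_meas_lt _ (ae_of_all _ hh0) hh.aemeasurable]
  refine (le_lintegral_add _ _).trans (lintegral_mono fun t => ?_)
  by_cases ht : ∃ z, t < f z
  · refine (volume_add_volume_le_of_isOpen (isOpen_lt continuous_const hf)
      (isOpen_lt continuous_const hg) ht ((hfg t).1 ht)).trans (measure_mono ?_)
    rintro _ ⟨z, hz, w, hw, rfl⟩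
    exact (lt_min hz hw).trans_le (hmin z w)
  · have ht' := ht
    rw [hfg] at ht'
    push Not at ht ht'
    simp [not_lt.2 (ht _), not_lt.2 (ht' _)]

/-- A real function on a normed space which is a norm equivalent to the given one. -/
structure IsEquivNorm {E : Type*} [NormedAddCommGroup E] [NormedSpace ℝ E] (N : E → ℝ) :
    Prop where
  add_le : ∀ x y, N (x + y) ≤ N x + N y
  smul : ∀ (c : ℝ) x, N (c • x) = |c| * N x
  lower : ∃ c > 0, ∀ x, c * ‖x‖ ≤ N x
  upper : ∃ C > 0, ∀ x, N x ≤ C * ‖x‖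

namespace IsEquivNorm

variable {E F : Type*} [NormedAddCommGroup E] [NormedSpace ℝ E]
  [NormedAddCommGroup F] [NormedSpace ℝ F] {N : E → ℝ}

lemma pos (hN : IsEquivNorm N) {x : E} (hx : x ≠ 0) : 0 < N x := by
  obtain ⟨c, hc, h⟩ := hN.lower
  exact (mul_pos hc (norm_pos_iff.2 hx)).trans_le (h x)

lemma nonneg (hN : IsEquivNorm N) (x : E) : 0 ≤ N x := by
  obtain ⟨c, hc, h⟩ := hN.lower
  exact (by positivity : 0 ≤ c * ‖x‖).trans (h x)

lemma continuous (hN : IsEquivNorm N) : Continuous N := by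
  obtain ⟨C, hC, h⟩ := hN.upper
  refine (LipschitzWith.of_le_add_mul (K := C.toNNReal) fun x y => ?_).continuous
  have := hN.add_le y (x - y)
  rw [add_sub_cancel] at this
  rw [dist_eq_norm, Real.coe_toNNReal _ hC.le]
  linarith [h (x - y)]

lemma comp (hN : IsEquivNorm N) (e : F →L[ℝ] E) {c : ℝ} (hc : 0 < c)
    (he : ∀ x, c * ‖x‖ ≤ ‖e x‖) : IsEquivNorm (fun x => N (e x)) where
  add_le x y := by simpa using hN.add_le (e x) (e y)
  smul a x := by simpa using hN.smul a (e x)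
  lower := by
    obtain ⟨d, hd, h⟩ := hN.lower
    refine ⟨d * c, by positivity, fun x => le_trans ?_ (h _)⟩
    rw [mul_assoc]
    gcongr
    exact he x
  upper := by
    obtain ⟨C, hC, h⟩ := hN.upper
    refine ⟨C * (‖e‖ + 1), by positivity, fun x => (h _).trans ?_⟩
    rw [mul_assoc]
    gcongr
    refine (e.le_opNorm x).trans ?_
    gcongr
    linarith

lemma pos_of_fst_ne_zero {N : E × F → ℝ} (hN : IsEquivNorm N) {p : E} (hp : p ≠ 0) (s : F) :
    0 < N (p, s) :=
  hN.pos (by simp [Prod.ext_iff, hp])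

lemma continuous_inv_section {N : E × F → ℝ} (hN : IsEquivNorm N) {p : E} (hp : p ≠ 0) :
    Continuous fun s : F => (N (p, s))⁻¹ :=
  Continuous.inv₀ (by have := hN.continuous; fun_prop) fun s => (hN.pos_of_fst_ne_zero hp s).ne'

lemma measurable_section {N : E × F → ℝ} [MeasurableSpace F] [BorelSpace F]
    (hN : IsEquivNorm N) {p : E} (hp : p ≠ 0) (k : ℕ) :
    Measurable fun s : F => ENNReal.ofReal ((N (p, s))⁻¹ ^ k) :=
  (((hN.continuous_inv_section hp).pow k).measurable).ennreal_ofReal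

/-- Two homogeneity-normalised profiles `s ↦ N (p, s)` and `s ↦ N (q, s)` satisfy a weighted
superadditivity inequality. -/
lemma exists_weights {N : E × ℝ → ℝ} (hN : IsEquivNorm N) (k : ℕ) {p q : E}
    (hp : p ≠ 0) (hq : q ≠ 0) (hpq : p + q ≠ 0) :
    ∃ a b : ℝ, 0 < a ∧ 0 < b ∧ a + b = 1 ∧
      ENNReal.ofReal (a ^ k) * (∫⁻ s, ENNReal.ofReal ((N (p, s))⁻¹ ^ k)) +
        ENNReal.ofReal (b ^ k) * (∫⁻ s, ENNReal.ofReal ((N (q, s))⁻¹ ^ k)) ≤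
      ∫⁻ s, ENNReal.ofReal ((N (p + q, s))⁻¹ ^ k) := by
  have hc := hN.continuous
  have hpos : ∀ {p : E}, p ≠ 0 → ∀ s : ℝ, 0 < N (p, s) := fun h s => hN.pos_of_fst_ne_zero h s
  have hcont : ∀ {p : E}, p ≠ 0 → Continuous fun s : ℝ => (N (p, s))⁻¹ := fun h =>
    hN.continuous_inv_section h
  obtain ⟨c, hc0, hlow⟩ := hN.lower
  have hmin : ∀ {p : E}, p ≠ 0 → ∃ s₀ : ℝ, ∀ s, N (p, s₀) ≤ N (p, s) := fun {p} h => by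
    refine (show Continuous fun s : ℝ => N (p, s) by fun_prop).exists_forall_le ?_
    refine Filter.tendsto_atTop_mono (f := fun s : ℝ => c * ‖s‖) (fun s => ?_)
      ((tendsto_norm_cocompact_atTop (E := ℝ)).const_mul_atTop hc0)
    refine le_trans ?_ (hlow (p, s))
    gcongr
    exact norm_snd_le (p, s)
  obtain ⟨s, hs⟩ := hmin hp
  obtain ⟨t, ht⟩ := hmin hq
  have h1 := hpos hp s
  have h2 := hpos hq t
  set m := N (p, s)
  set l := N (q, t)
  have hw : ∀ {x : ℝ}, 0 ≤ x → ∀ {p : E}, p ≠ 0 → ∀ z, 0 ≤ (x * (N (p, z))⁻¹) ^ k :=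
    fun hx p hp z => by have := hpos hp z; positivity
  refine ⟨m / (m + l), l / (m + l), by positivity, by positivity, by field_simp, ?_⟩
  rw [← lintegral_const_mul _ (hN.measurable_section hp k),
    ← lintegral_const_mul _ (hN.measurable_section hq k)]
  simp_rw [← ENNReal.ofReal_mul (show 0 ≤ (m / (m + l)) ^ k by positivity),
    ← ENNReal.ofReal_mul (show 0 ≤ (l / (m + l)) ^ k by positivity), ← mul_pow]
  apply lintegral_add_lintegral_le_of_min_le
  · have := hcont hp; fun_prop
  · have := hcont hq; fun_prop
  · have := hcont hpq; exact Continuous.measurable (by fun_prop)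
  · exact hw (by positivity) hp
  · exact hw (by positivity) hq
  · intro z; have := hpos hpq z; show 0 ≤ (N (p + q, z))⁻¹ ^ k; positivity
  · have key1 : ∀ z, (m / (m + l) * (N (p, z))⁻¹) ^ k ≤ ((m + l)⁻¹) ^ k := fun z => by
      have := hpos hp z
      gcongr
      rw [div_mul_eq_mul_div, ← div_eq_mul_inv, div_le_iff₀ (by positivity),
        inv_mul_cancel₀ (by positivity), div_le_one this]
      exact hs z
    have key2 : ∀ z, (l / (m + l) * (N (q, z))⁻¹) ^ k ≤ ((m + l)⁻¹) ^ k := fun z => by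
      have := hpos hq z
      gcongr
      rw [div_mul_eq_mul_div, ← div_eq_mul_inv, div_le_iff₀ (by positivity),
        inv_mul_cancel₀ (by positivity), div_le_one this]
      exact ht z
    intro τ
    refine ⟨fun ⟨z, hz⟩ => ⟨t, hz.trans_le ((key1 z).trans_eq ?_)⟩,
      fun ⟨z, hz⟩ => ⟨s, hz.trans_le ((key2 z).trans_eq ?_)⟩⟩
    · change _ = (l / (m + l) * l⁻¹) ^ k
      congr 1; field_simp
    · change _ = (m / (m + l) * m⁻¹) ^ k
      congr 1; field_simp
  · intro z w
    have h3 := hpos hp z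
    have h4 := hpos hq w
    have h5 := hpos hpq (z + w)
    have h6 : N (p + q, z + w) ≤ N (p, z) + N (q, w) := hN.add_le (p, z) (q, w)
    have h7 : min (m / (m + l) * (N (p, z))⁻¹) (l / (m + l) * (N (q, w))⁻¹) ≤
        (N (p + q, z + w))⁻¹ := by
      rw [le_inv_comm₀ (by positivity) h5]
      refine h6.trans ?_
      rw [le_inv_comm₀ (by positivity) (by positivity)]
      by_contra! hcon
      obtain ⟨h8, h9⟩ := lt_min_iff.1 hcon
      rw [inv_lt_iff_one_lt_mul₀ (by positivity)] at h8 h9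
      have h10 : N (p, z) * 1 < (N (p, z) + N (q, w)) * (m / (m + l)) := by
        calc _ < N (p, z) * ((N (p, z) + N (q, w)) * (m / (m + l) * (N (p, z))⁻¹)) := by
              gcongr; linarith
          _ = _ := by field_simp
      have h11 : N (q, w) * 1 < (N (p, z) + N (q, w)) * (l / (m + l)) := by
        calc _ < N (q, w) * ((N (p, z) + N (q, w)) * (l / (m + l) * (N (q, w))⁻¹)) := by
              gcongr; linarith
          _ = _ := by field_simp
      have h12 : m / (m + l) + l / (m + l) = 1 := by field_simp
      have h13 : (N (p, z) + N (q, w)) * (m / (m + l)) + (N (p, z) + N (q, w)) * (l / (m + l))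
        = N (p, z) + N (q, w) := by rw [← mul_add, h12, mul_one]
      linarith
    rcases min_le_iff.1 h7 with h8 | h8
    · exact min_le_of_left_le (pow_le_pow_left₀ (by positivity) h8 k)
    · exact min_le_of_right_le (pow_le_pow_left₀ (by positivity) h8 k)

lemma lintegral_section_smul {N : E × ℝ → ℝ} (hN : IsEquivNorm N) (j : ℕ) {p : E} (hp : p ≠ 0)
    {c : ℝ} (hc : c ≠ 0) :
    ∫⁻ s, ENNReal.ofReal ((N (c • p, s))⁻¹ ^ (j + 1)) =
      ENNReal.ofReal (|c|⁻¹ ^ j) * ∫⁻ s, ENNReal.ofReal ((N (p, s))⁻¹ ^ (j + 1)) := by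
  have hcp : c • p ≠ 0 := smul_ne_zero hc hp
  have hc' : 0 < |c| := abs_pos.2 hc
  nth_rewrite 1 [← Real.smul_map_volume_mul_left hc]
  rw [lintegral_smul_measure, lintegral_map (hN.measurable_section hcp _) (by fun_prop),
    ← lintegral_const_mul _ (hN.measurable_section hp _), smul_eq_mul,
    ← lintegral_const_mul (f := fun s => ENNReal.ofReal ((N (c • p, c * s))⁻¹ ^ (j + 1))) _
      ((hN.measurable_section hcp (j + 1)).comp (measurable_const_mul c))]
  refine lintegral_congr fun s => ?_
  rw [← ENNReal.ofReal_mul hc'.le, ← ENNReal.ofReal_mul (by positivity)]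
  have : N (c • p, c * s) = |c| * N (p, s) := hN.smul c (p, s)
  rw [this]
  have := hN.pos_of_fst_ne_zero hp s
  congr 1
  simp only [inv_pow, mul_pow, pow_succ]
  field_simp

lemma lintegral_max_one_abs_pos (k : ℕ) :
    0 < ∫⁻ s : ℝ, ENNReal.ofReal ((max 1 |s|)⁻¹ ^ k) := by
  rw [lintegral_pos_iff_support (by fun_prop)]
  have : Function.support (fun s : ℝ => ENNReal.ofReal ((max 1 |s|)⁻¹ ^ k)) = Set.univ := by
    ext s
    have : 0 < (max 1 |s|)⁻¹ ^ k := by positivity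
    simp only [Function.mem_support, Set.mem_univ, iff_true]
    exact (ENNReal.ofReal_pos.2 this).ne'
  rw [this]
  simp

lemma lintegral_max_one_abs_lt_top {k : ℕ} (hk : 1 < k) :
    ∫⁻ s : ℝ, ENNReal.ofReal ((max 1 |s|)⁻¹ ^ k) < ⊤ := by
  have h := (integrable_one_add_norm (E := ℝ) (μ := volume) (r := k) (by simpa using hk)).const_mul
    ((2 : ℝ) ^ k)
  refine lt_of_le_of_lt (lintegral_mono fun s => ENNReal.ofReal_le_ofReal ?_)
    h.lintegral_lt_top
  rw [Real.rpow_neg (by positivity), Real.rpow_natCast, ← inv_pow, ← mul_pow]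
  gcongr
  rw [inv_le_iff_one_le_mul₀ (by positivity), mul_comm (2 : ℝ), mul_assoc, mul_comm, ← div_eq_mul_inv,
    le_div_iff₀ (by positivity), Real.norm_eq_abs]
  linarith [le_max_left 1 |s|, le_max_right 1 |s|]

/-- Integrating a power of the reciprocal of a norm along a line yields a norm on the quotient. -/
theorem exists_lintegral_line {N : E × ℝ → ℝ} (hN : IsEquivNorm N) {j : ℕ} (hj : j ≠ 0) :
    ∃ M : E → ℝ, IsEquivNorm M ∧ ∀ p ≠ 0,
      ∫⁻ s, ENNReal.ofReal ((N (p, s))⁻¹ ^ (j + 1)) = ENNReal.ofReal ((M p)⁻¹ ^ j) := by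
  set I : E → ENNReal := fun p => ∫⁻ s, ENNReal.ofReal ((N (p, s))⁻¹ ^ (j + 1)) with hI
  set J := ∫⁻ s : ℝ, ENNReal.ofReal ((max 1 |s|)⁻¹ ^ (j + 1)) with hJ
  have hJ0 : 0 < J := lintegral_max_one_abs_pos _
  have hJt : J < ⊤ := lintegral_max_one_abs_lt_top (by omega)
  have hJr : 0 < J.toReal := ENNReal.toReal_pos hJ0.ne' hJt.ne
  obtain ⟨c, hc, hlow⟩ := hN.lower
  obtain ⟨C, hC, hupp⟩ := hN.upper
  have hmeas : Measurable fun s : ℝ => ENNReal.ofReal ((max 1 |s|)⁻¹ ^ (j + 1)) := by fun_prop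
  have hI1 : ∀ p : E, ‖p‖ = 1 → I p ≤ ENNReal.ofReal (c⁻¹ ^ (j + 1)) * J := fun p hp => by
    rw [hJ, ← lintegral_const_mul _ hmeas]
    refine lintegral_mono fun s => ?_
    rw [← ENNReal.ofReal_mul (by positivity), ← mul_pow, ← mul_inv]
    apply ENNReal.ofReal_le_ofReal
    have := hN.nonneg (p, s)
    gcongr
    simpa [Prod.norm_def, hp] using hlow (p, s)
  have hI2 : ∀ p : E, ‖p‖ = 1 → ENNReal.ofReal (C⁻¹ ^ (j + 1)) * J ≤ I p := fun p hp => by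
    rw [hJ, ← lintegral_const_mul _ hmeas]
    refine lintegral_mono fun s => ?_
    have := hN.pos_of_fst_ne_zero (p := p) (by rintro rfl; simp at hp) s
    rw [← ENNReal.ofReal_mul (by positivity), ← mul_pow, ← mul_inv]
    apply ENNReal.ofReal_le_ofReal
    gcongr
    simpa [Prod.norm_def, hp] using hupp (p, s)
  have hnorm : ∀ p : E, p ≠ 0 → ‖‖p‖⁻¹ • p‖ = 1 := fun p hp => by
    have := norm_ne_zero_iff.2 hp
    simp [norm_smul, this]
  have hsm : ∀ (a : ℝ) (p : E), a ≠ 0 → p ≠ 0 → I (a • p) = ENNReal.ofReal (|a|⁻¹ ^ j) * I p :=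
    fun a p ha hp => hN.lintegral_section_smul j hp ha
  have hIt1 : ∀ p : E, ‖p‖ = 1 → I p ≠ ⊤ := fun p hp =>
    ((hI1 p hp).trans_lt (ENNReal.mul_lt_top ENNReal.ofReal_lt_top hJt)).ne
  have hI01 : ∀ p : E, ‖p‖ = 1 → I p ≠ 0 := fun p hp =>
    ((ENNReal.mul_pos (by simp; positivity) hJ0.ne').trans_le (hI2 p hp)).ne'
  have hI' : ∀ p : E, p ≠ 0 → I p ≠ ⊤ ∧ I p ≠ 0 := fun p hp => by
    have h1 := norm_ne_zero_iff.2 hp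
    have h2 := hsm ‖p‖ (‖p‖⁻¹ • p) h1 (smul_ne_zero (inv_ne_zero h1) hp)
    rw [smul_inv_smul₀ h1] at h2
    rw [h2]
    refine ⟨ENNReal.mul_ne_top ENNReal.ofReal_ne_top (hIt1 _ (hnorm p hp)),
      mul_ne_zero ?_ (hI01 _ (hnorm p hp))⟩
    simp; positivity
  have hIr : ∀ p : E, p ≠ 0 → 0 < (I p).toReal := fun p hp =>
    ENNReal.toReal_pos (hI' p hp).2 (hI' p hp).1
  set M : E → ℝ := fun p => if p = 0 then 0 else (I p).toReal⁻¹ ^ ((j : ℝ)⁻¹) with hM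
  have hM0 : M 0 = 0 := by simp [hM]
  have hMp : ∀ p, p ≠ 0 → 0 < M p := fun p hp => by
    have := hIr p hp
    simp only [hM, hp, if_false]
    positivity
  have hMn : ∀ p, 0 ≤ M p := fun p => by
    by_cases hp : p = 0
    · rw [hp, hM0]
    · exact (hMp p hp).le
  have hMj : ∀ p, p ≠ 0 → M p ^ j = (I p).toReal⁻¹ := fun p hp => by
    have := hIr p hp
    simp only [hM, hp, if_false]
    exact Real.rpow_inv_natCast_pow (by positivity) hj
  have hMs : ∀ (a : ℝ) p, M (a • p) = |a| * M p := fun a p => by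
    by_cases ha : a = 0
    · simp [ha, hM0]
    by_cases hp : p = 0
    · simp [hp, hM0]
    have ha' : 0 < |a| := abs_pos.2 ha
    rw [← pow_left_inj₀ (hMn _) (mul_nonneg ha'.le (hMn p)) hj, mul_pow,
      hMj _ (smul_ne_zero ha hp), hMj p hp, hsm a p ha hp, ENNReal.toReal_mul,
      ENNReal.toReal_ofReal (by positivity), mul_inv, inv_pow, inv_inv]
  have hscale : ∀ p : E, p ≠ 0 → M p = M (‖p‖⁻¹ • p) * ‖p‖ := fun p hp => by
    have := norm_pos_iff.2 hp
    rw [hMs, abs_of_pos (by positivity)]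
    field_simp
  refine ⟨M, ⟨fun p q => ?_, hMs, ?_, ?_⟩, fun p hp => ?_⟩
  · by_cases hp : p = 0
    · simp [hp, hM0]
    by_cases hq : q = 0
    · simp [hq, hM0]
    by_cases hpq : p + q = 0
    · rw [hpq, hM0]
      exact add_nonneg (hMn p) (hMn q)
    obtain ⟨a, b, ha, hb, hab, h⟩ := hN.exists_weights (j + 1) hp hq hpq
    have hA := hMp p hp
    have hB := hMp q hq
    have hD := hMp _ hpq
    have h' := ENNReal.toReal_mono (hI' _ hpq).1 h
    rw [ENNReal.toReal_add (ENNReal.mul_ne_top ENNReal.ofReal_ne_top (hI' _ hp).1)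
      (ENNReal.mul_ne_top ENNReal.ofReal_ne_top (hI' _ hq).1), ENNReal.toReal_mul,
      ENNReal.toReal_mul, ENNReal.toReal_ofReal (by positivity),
      ENNReal.toReal_ofReal (by positivity)] at h'
    change a ^ (j + 1) * (I p).toReal + b ^ (j + 1) * (I q).toReal ≤ (I (p + q)).toReal at h'
    rw [← inv_inv (I p).toReal, ← inv_inv (I q).toReal, ← inv_inv (I (p + q)).toReal,
      ← hMj p hp, ← hMj q hq, ← hMj _ hpq] at h'
    have hconv := (convexOn_zpow (𝕜 := ℝ) (-(j : ℤ))).2 (x := M p / a) (y := M q / b)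
      (Set.mem_Ioi.2 (by positivity)) (Set.mem_Ioi.2 (by positivity)) ha.le hb.le hab
    simp only [smul_eq_mul, zpow_neg, zpow_natCast] at hconv
    rw [mul_div_cancel₀ _ ha.ne', mul_div_cancel₀ _ hb.ne'] at hconv
    have h2 : ((M p + M q) ^ j)⁻¹ ≤ (M (p + q) ^ j)⁻¹ := by
      refine hconv.trans (le_trans (le_of_eq ?_) h')
      simp only [div_pow, pow_succ]
      field_simp
    rw [inv_le_inv₀ (by positivity) (by positivity)] at h2
    exact le_of_pow_le_pow_left₀ hj (by positivity) h2
  · refine ⟨(c ^ (j + 1) / J.toReal) ^ ((j : ℝ)⁻¹), by positivity, fun p => ?_⟩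
    by_cases hp : p = 0
    · simp [hp, hM0]
    have hu : ‖p‖⁻¹ • p ≠ 0 := smul_ne_zero (inv_ne_zero (norm_ne_zero_iff.2 hp)) hp
    rw [hscale p hp]
    gcongr
    refine le_of_pow_le_pow_left₀ hj (hMn _) ?_
    rw [Real.rpow_inv_natCast_pow (by positivity) hj, hMj _ hu,
      le_inv_comm₀ (by positivity) (hIr _ hu)]
    have := ENNReal.toReal_mono (ENNReal.mul_ne_top ENNReal.ofReal_ne_top hJt.ne)
      (hI1 _ (hnorm p hp))
    rw [ENNReal.toReal_mul, ENNReal.toReal_ofReal (by positivity)] at this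
    refine this.trans_eq ?_
    rw [inv_pow]
    field_simp
  · refine ⟨(C ^ (j + 1) / J.toReal) ^ ((j : ℝ)⁻¹), by positivity, fun p => ?_⟩
    by_cases hp : p = 0
    · simp [hp, hM0]
    have hu : ‖p‖⁻¹ • p ≠ 0 := smul_ne_zero (inv_ne_zero (norm_ne_zero_iff.2 hp)) hp
    rw [hscale p hp]
    gcongr
    refine le_of_pow_le_pow_left₀ hj (by positivity) ?_
    rw [Real.rpow_inv_natCast_pow (by positivity) hj, hMj _ hu,
      inv_le_comm₀ (hIr _ hu) (by positivity)]
    have := ENNReal.toReal_mono (hIt1 _ (hnorm p hp)) (hI2 _ (hnorm p hp))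
    rw [ENNReal.toReal_mul, ENNReal.toReal_ofReal (by positivity)] at this
    refine le_trans (le_of_eq ?_) this
    rw [inv_pow]
    field_simp
  · rw [inv_pow, hMj p hp, inv_inv, ENNReal.ofReal_toReal (hI' p hp).1]

/-- Integrating a power of the reciprocal of a norm along `ℝ^m` yields a norm on the quotient. -/
theorem exists_lintegral_pi {j : ℕ} (hj : j ≠ 0) (m : ℕ) {N : E × (Fin m → ℝ) → ℝ}
    (hN : IsEquivNorm N) :
    ∃ M : E → ℝ, IsEquivNorm M ∧ ∀ p ≠ 0,
      ∫⁻ z, ENNReal.ofReal ((N (p, z))⁻¹ ^ (j + m)) = ENNReal.ofReal ((M p)⁻¹ ^ j) := by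
  induction m with
  | zero =>
    refine ⟨fun p => N (p, 0), hN.comp (ContinuousLinearMap.inl ℝ E (Fin 0 → ℝ)) one_pos ?_,
      fun p hp => ?_⟩
    · simp [Prod.norm_def]
    · rw [volume_pi, Measure.pi_of_empty _ 0, lintegral_dirac, add_zero]
  | succ m ih =>
    let e : (E × (Fin m → ℝ)) × ℝ →L[ℝ] E × (Fin (m + 1) → ℝ) :=
      ((ContinuousLinearMap.fst ℝ E (Fin m → ℝ)).comp (ContinuousLinearMap.fst ℝ _ ℝ)).prod
        ((Fin.consEquivL ℝ (fun _ : Fin (m + 1) => ℝ) : _ →L[ℝ] _).comp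
          ((ContinuousLinearMap.snd ℝ _ ℝ).prod
            ((ContinuousLinearMap.snd ℝ E (Fin m → ℝ)).comp (ContinuousLinearMap.fst ℝ _ ℝ))))
    have he : ∀ x, e x = (x.1.1, Fin.cons x.2 x.1.2) := fun x => rfl
    have hN1 : IsEquivNorm fun x => N (e x) := by
      refine hN.comp e one_pos fun x => ?_
      rw [one_mul, he, Prod.norm_def, Prod.norm_def, Prod.norm_def]
      refine max_le (max_le (le_max_left _ _) (le_max_of_le_right ?_)) (le_max_of_le_right ?_)
      · refine (pi_norm_le_iff_of_nonneg (norm_nonneg _)).2 fun i => ?_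
        simpa using norm_le_pi_norm (Fin.cons x.2 x.1.2 : Fin (m + 1) → ℝ) i.succ
      · simpa using norm_le_pi_norm (Fin.cons x.2 x.1.2 : Fin (m + 1) → ℝ) 0
    obtain ⟨N₂, hN₂, hI₂⟩ := hN1.exists_lintegral_line (j := j + m) (by omega)
    obtain ⟨M, hM, hMI⟩ := ih hN₂
    refine ⟨M, hM, fun p hp => ?_⟩
    rw [← hMI p hp]
    have hm := hN.measurable_section hp (j + (m + 1))
    have hmp := (volume_preserving_piFinSuccAbove (fun _ : Fin (m + 1) => ℝ) 0).symm
    rw [← hmp.lintegral_comp hm, Measure.volume_eq_prod]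
    refine (lintegral_prod_symm' _ (hm.comp hmp.measurable)).trans ?_
    refine lintegral_congr fun z => ?_
    rw [← hI₂ (p, z) (by simp [Prod.ext_iff, hp])]
    refine lintegral_congr fun s => ?_
    rw [he, add_assoc]
    simp [MeasurableEquiv.piFinSuccAbove, Fin.insertNthEquiv]

end IsEquivNorm

/-- The volume of the unit ball of a norm on `ℝ × ℝ^m`, in central projection coordinates. -/
lemma IsEquivNorm.volume_unitBall {m : ℕ} {N : ℝ × (Fin m → ℝ) → ℝ} (hN : IsEquivNorm N) :
    volume {x | N x ≤ 1} =
      (∫⁻ r : ℝ, {r : ℝ | |r| ≤ 1}.indicator (fun r => ENNReal.ofReal (|r| ^ m)) r) *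
        ∫⁻ z, ENNReal.ofReal ((N (1, z))⁻¹ ^ (1 + m)) := by
  have hcont := hN.continuous
  have hpos : ∀ z : Fin m → ℝ, 0 < N (1, z) := hN.pos_of_fst_ne_zero one_ne_zero
  have hslice : ∀ r : ℝ, r ≠ 0 → volume (Prod.mk r ⁻¹' {x | N x ≤ 1}) =
      ∫⁻ z : Fin m → ℝ, {x : ℝ × (Fin m → ℝ) | |x.1| * N (1, x.2) ≤ 1}.indicator
        (fun x => ENNReal.ofReal (|x.1| ^ m)) (r, z) := fun r hr => by
    have hset : Prod.mk r ⁻¹' {x | N x ≤ 1} =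
        (r⁻¹ • ·) ⁻¹' {z : Fin m → ℝ | |r| * N (1, z) ≤ 1} := by
      ext z
      have := hN.smul r (1, r⁻¹ • z)
      simp only [Prod.smul_mk, smul_inv_smul₀ hr, smul_eq_mul, mul_one] at this
      simp [this]
    have hms : MeasurableSet {z : Fin m → ℝ | |r| * N (1, z) ≤ 1} :=
      (isClosed_le (by fun_prop) continuous_const).measurableSet
    rw [hset, Measure.addHaar_preimage_smul _ (inv_ne_zero hr), ← setLIntegral_const,
      ← lintegral_indicator hms]
    refine lintegral_congr fun z => ?_
    simp [Set.indicator_apply, abs_pow]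
  have hmS : MeasurableSet {x : ℝ × (Fin m → ℝ) | |x.1| * N (1, x.2) ≤ 1} :=
    (isClosed_le (by fun_prop) continuous_const).measurableSet
  have hmI : Measurable ({x : ℝ × (Fin m → ℝ) | |x.1| * N (1, x.2) ≤ 1}.indicator
      fun x => ENNReal.ofReal (|x.1| ^ m)) := Measurable.indicator (by fun_prop) hmS
  have hmR : Measurable ({r : ℝ | |r| ≤ 1}.indicator fun r => ENNReal.ofReal (|r| ^ m)) :=
    Measurable.indicator (by fun_prop)
      (isClosed_le continuous_abs continuous_const).measurableSet
  rw [Measure.volume_eq_prod,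
    Measure.prod_apply (isClosed_le hcont continuous_const).measurableSet]
  calc _ = ∫⁻ r : ℝ, ∫⁻ z : Fin m → ℝ, {x : ℝ × (Fin m → ℝ) | |x.1| * N (1, x.2) ≤ 1}.indicator
        (fun x => ENNReal.ofReal (|x.1| ^ m)) (r, z) := by
        apply lintegral_congr_ae
        filter_upwards [Measure.ae_ne volume (0 : ℝ)] with r hr using hslice r hr
    _ = ∫⁻ z : Fin m → ℝ, ∫⁻ r : ℝ, {x : ℝ × (Fin m → ℝ) | |x.1| * N (1, x.2) ≤ 1}.indicator
        (fun x => ENNReal.ofReal (|x.1| ^ m)) (r, z) :=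
        lintegral_lintegral_swap hmI.aemeasurable
    _ = _ := by
        rw [← lintegral_const_mul _ (hN.measurable_section one_ne_zero _)]
        refine lintegral_congr fun z => ?_
        have hz := hpos z
        have ha : (N (1, z))⁻¹ ≠ 0 := (inv_pos.2 hz).ne'
        have hmz := hmI.comp (measurable_prodMk_right (y := z))
        nth_rewrite 1 [← Real.smul_map_volume_mul_left ha]
        rw [lintegral_smul_measure]
        refine (congrArg _ (lintegral_map hmz (by fun_prop))).trans ?_
        rw [mul_comm, ← lintegral_const_mul _ hmR, smul_eq_mul]
        refine (lintegral_const_mul _ (hmz.comp (measurable_const_mul _))).symm.trans ?_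
        refine lintegral_congr fun r => ?_
        have habs : |(N (1, z))⁻¹ * r| = (N (1, z))⁻¹ * |r| := by
          rw [abs_mul, abs_of_pos (inv_pos.2 hz)]
        have hiff : |(N (1, z))⁻¹ * r| * N (1, z) ≤ 1 ↔ |r| ≤ 1 := by
          rw [habs]; field_simp
        simp only [Function.comp, Set.indicator_apply, Set.mem_ofPred_eq, hiff]
        split_ifs
        · rw [habs, abs_of_pos (inv_pos.2 hz), ← ENNReal.ofReal_mul (by positivity),
            ← ENNReal.ofReal_mul (by positivity)]
          congr 1
          ring
        · simp

section Body

variable {V : Type*} [NormedAddCommGroup V] [NormedSpace ℝ V] {K : Set V}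

lemma mem_nhds_zero_of_symmetric (hK_conv : Convex ℝ K) (hK_int : (interior K).Nonempty)
    (hK_sym : K = -K) : K ∈ nhds (0 : V) := by
  obtain ⟨x, hx⟩ := hK_int
  have hx' : -x ∈ interior K := by
    refine mem_interior.2 ⟨-interior K, ?_, isOpen_interior.neg, by simpa using hx⟩
    rw [hK_sym, Set.neg_subset_neg, ← hK_sym]
    exact interior_subset
  rw [← mem_interior_iff_mem_nhds]
  have := hK_conv.interior hx hx' (a := 1 / 2) (b := 1 / 2) (by norm_num) (by norm_num)
    (by norm_num)
  simpa using this

lemma isEquivNorm_gauge (hK_cpt : IsCompact K) (hK_conv : Convex ℝ K)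
    (hK0 : K ∈ nhds (0 : V)) (hK_sym : K = -K) : IsEquivNorm (gauge K) where
  add_le := gauge_add_le hK_conv (absorbent_nhds_zero hK0)
  smul c x := by
    have hneg : ∀ x ∈ K, -x ∈ K := fun x hx => by
      rw [hK_sym] at hx
      simpa using hx
    rcases le_total 0 c with hc | hc
    · rw [gauge_smul_of_nonneg hc, abs_of_nonneg hc, smul_eq_mul]
    · rw [← gauge_neg hneg, ← neg_smul, gauge_smul_of_nonneg (neg_nonneg.2 hc),
        abs_of_nonpos hc, smul_eq_mul]
  lower := by
    obtain ⟨R, hR, hsub⟩ := hK_cpt.isBounded.subset_closedBall_lt 0 0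
    refine ⟨R⁻¹, inv_pos.2 hR, fun x => ?_⟩
    rw [inv_mul_eq_div]
    exact le_gauge_of_subset_closedBall (absorbent_nhds_zero hK0) hR.le hsub
  upper := by
    obtain ⟨r, hr, hsub⟩ := Metric.mem_nhds_iff.1 hK0
    refine ⟨r⁻¹, inv_pos.2 hr, fun x => ?_⟩
    rw [inv_mul_eq_div, le_div_iff₀ hr, mul_comm]
    exact mul_gauge_le_norm hsub

end Body

section Sections

variable {n : ℕ} {K : Set (EuclideanSpace ℝ (Fin n))}

lemma sectVol_smul {c : ℝ} (hc : c ≠ 0) (x : EuclideanSpace ℝ (Fin n)) :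
    sectVol n K (c • x) = sectVol n K x := by
  simp [sectVol, inner_smul_right, hc]

lemma NK_smul (c : ℝ) (x : EuclideanSpace ℝ (Fin n)) : NK n K (c • x) = |c| * NK n K x := by
  by_cases hc : c = 0
  · simp [NK, hc]
  by_cases hx : x = 0
  · simp [NK, hx]
  simp [NK, hc, hx, sectVol_smul hc, norm_smul, mul_div_assoc]

lemma NK_nonneg (x : EuclideanSpace ℝ (Fin n)) : 0 ≤ NK n K x := by
  unfold NK sectVol
  split_ifs <;> positivity

lemma sectVol_pos (hK_cpt : IsCompact K) (hK0 : K ∈ nhds 0) {x : EuclideanSpace ℝ (Fin n)}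
    (hx : x ≠ 0) : 0 < sectVol n K x := by
  set W : Submodule ℝ (EuclideanSpace ℝ (Fin n)) := (Submodule.span ℝ {x})ᗮ
  have hW : ((Module.finrank ℝ W : ℕ) : ℝ) = (n : ℝ) - 1 := by
    have h := (Submodule.span ℝ {x}).finrank_add_finrank_orthogonal
    rw [finrank_span_singleton hx, finrank_euclideanSpace_fin] at h
    have h' : 1 + (Module.finrank ℝ W : ℝ) = n := by exact_mod_cast h
    linarith
  have hset : K ∩ {y | inner ℝ y x = (0 : ℝ)} = W.subtypeₗᵢ '' (W.subtypeₗᵢ ⁻¹' K) := by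
    rw [Set.image_preimage_eq_inter_range]
    congr 1
    ext y
    simp [W, Submodule.mem_orthogonal_singleton_iff_inner_left]
  have hc : IsCompact (W.subtypeₗᵢ ⁻¹' K) :=
    (W.subtypeₗᵢ.isometry.isClosedEmbedding).isCompact_preimage hK_cpt
  have hnhds : W.subtypeₗᵢ ⁻¹' K ∈ nhds 0 :=
    W.subtypeₗᵢ.continuous.continuousAt.preimage_mem_nhds (by simpa using hK0)
  unfold sectVol
  rw [hset, ← hW, W.subtypeₗᵢ.isometry.hausdorffMeasure_image (Or.inl (by positivity))]
  exact ENNReal.toReal_pos (Measure.measure_pos_of_mem_nhds _ hnhds).ne' hc.measure_lt_top.ne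

end Sections

/-- Coordinates adapted to a subspace `P` and an orthonormal basis of its orthogonal complement. -/
lemma Submodule.exists_orthogonal_coordinates {V : Type*} [NormedAddCommGroup V]
    [InnerProductSpace ℝ V] [FiniteDimensional ℝ V] (P : Submodule ℝ V) {m : ℕ}
    (hm : Module.finrank ℝ Pᗮ = m) :
    ∃ e : (P × (Fin m → ℝ)) →ₗ[ℝ] V, (∀ p z, ‖e (p, z)‖ ^ 2 = ‖p‖ ^ 2 + ∑ i, z i ^ 2) ∧
      (∀ p z (q : P), inner ℝ (e (p, z)) (q : V) = inner ℝ p q) ∧ Function.Surjective e := by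
  subst hm
  let f : (Fin (Module.finrank ℝ Pᗮ) → ℝ) →ₗ[ℝ] Pᗮ :=
    (stdOrthonormalBasis ℝ Pᗮ).repr.symm.toLinearEquiv.toLinearMap ∘ₗ
      (WithLp.linearEquiv 2 ℝ (Fin (Module.finrank ℝ Pᗮ) → ℝ)).symm.toLinearMap
  have hf : ∀ z, ‖f z‖ ^ 2 = ∑ i, z i ^ 2 := fun z => by
    simp [f, EuclideanSpace.norm_sq_eq]
  refine ⟨P.subtype.coprod (Pᗮ.subtype ∘ₗ f), fun p z => ?_, fun p z q => ?_, fun v => ?_⟩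
  · have horth : inner ℝ (p : V) (f z : V) = 0 := (f z).2 p p.2
    have := norm_add_sq_eq_norm_sq_add_norm_sq_of_inner_eq_zero (p : V) (f z : V) horth
    simp only [← sq] at this
    simpa [hf, ← coe_norm] using this
  · have horth : inner ℝ (f z : V) (q : V) = 0 := by
      rw [real_inner_comm]
      exact (f z).2 q q.2
    simp [inner_add_left, horth]
  · have hsurj : Function.Surjective f :=
      (stdOrthonormalBasis ℝ Pᗮ).repr.symm.surjective.comp
        (WithLp.linearEquiv 2 ℝ (Fin (Module.finrank ℝ Pᗮ) → ℝ)).symm.surjective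
    obtain ⟨p, hp, q, hq, rfl⟩ := P.exists_add_mem_mem_orthogonal v
    obtain ⟨z, hz⟩ := hsurj ⟨q, hq⟩
    exact ⟨(⟨p, hp⟩, z), by simp [hz]⟩

/-- A central section seen in orthogonal coordinates `ℝ × ℝ^m` on the hyperplane. -/
lemma hausdorffMeasure_image_unitBall {V : Type*} [NormedAddCommGroup V] [InnerProductSpace ℝ V]
    [MeasurableSpace V] [BorelSpace V] (m : ℕ) :
    ∃ c : ENNReal, ∀ (L : ℝ × (Fin m → ℝ) →ₗ[ℝ] V) (N : V → ℝ),
      (∀ x, ‖L x‖ ^ 2 = x.1 ^ 2 + ∑ i, x.2 i ^ 2) → IsEquivNorm (fun x => N (L x)) →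
      Measure.hausdorffMeasure ((m : ℝ) + 1) (L '' {x | N (L x) ≤ 1}) =
        c * ∫⁻ z, ENNReal.ofReal ((N (L (1, z)))⁻¹ ^ (1 + m)) := by
  let E := EuclideanSpace ℝ (Fin (m + 1))
  have hdim : ((Module.finrank ℝ E : ℕ) : ℝ) = (m : ℝ) + 1 := by simp [E]
  let g : E ≃ᵐ ℝ × (Fin m → ℝ) :=
    (MeasurableEquiv.toLp 2 (Fin (m + 1) → ℝ)).symm.trans
      (MeasurableEquiv.piFinSuccAbove (fun _ => ℝ) 0)
  have hg : MeasurePreserving g volume volume :=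
    (volume_preserving_piFinSuccAbove (fun _ => ℝ) 0).comp
      (PiLp.volume_preserving_ofLp (Fin (m + 1)))
  let μ : Measure E := Measure.hausdorffMeasure (Module.finrank ℝ E : ℕ)
  refine ⟨(Measure.addHaarScalarFactor μ volume : ENNReal) * ∫⁻ r : ℝ, {r : ℝ | |r| ≤ 1}.indicator
    (fun r => ENNReal.ofReal (|r| ^ m)) r, fun L N hL hN => ?_⟩
  let Λ : E →ₗ[ℝ] V :=
    { toFun := fun v => L (g v)
      map_add' := fun v w => by rw [← map_add]; rfl
      map_smul' := fun a v => by rw [RingHom.id_apply, ← map_smul]; rfl }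
  have hΛ : Isometry Λ := AddMonoidHomClass.isometry_of_norm _ fun v => by
    rw [← sq_eq_sq₀ (norm_nonneg _) (norm_nonneg _), EuclideanSpace.real_norm_sq_eq,
      Fin.sum_univ_succ]
    exact hL (g v)
  have himage : L '' {x | N (L x) ≤ 1} = Λ '' (g ⁻¹' {x | N (L x) ≤ 1}) := by
    conv_lhs => rw [← Set.image_preimage_eq {x | N (L x) ≤ 1} g.surjective, Set.image_image]
    rfl
  rw [himage, ← hdim, hΛ.hausdorffMeasure_image (Or.inl (by positivity))]
  refine (DFunLike.congr_fun (Measure.isAddLeftInvariant_eq_smul μ volume) _).trans ?_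
  rw [mul_assoc, ← hN.volume_unitBall, ← hg.measure_preimage_equiv]
  rfl

lemma NK_add_le_of_finrank_eq_two {n : ℕ} {K : Set (EuclideanSpace ℝ (Fin n))}
    (hK_cpt : IsCompact K) (hK_conv : Convex ℝ K) (hK0 : K ∈ nhds 0) (hK_sym : K = -K)
    (P : Submodule ℝ (EuclideanSpace ℝ (Fin n))) (hP : Module.finrank ℝ P = 2) (p q : P) :
    NK n K (p + q) ≤ NK n K p + NK n K q := by
  obtain ⟨m, hm⟩ : ∃ m, Module.finrank ℝ Pᗮ = m := ⟨_, rfl⟩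
  have hn : (n : ℝ) - 1 = m + 1 := by
    have h := P.finrank_add_finrank_orthogonal
    rw [hP, hm, finrank_euclideanSpace_fin] at h
    have h' : (2 : ℝ) + m = n := by exact_mod_cast h
    linarith
  obtain ⟨e, he_norm, he_inner, he_surj⟩ := P.exists_orthogonal_coordinates hm
  have hgauge := isEquivNorm_gauge hK_cpt hK_conv hK0 hK_sym
  have hN : IsEquivNorm (fun x => gauge K (e x)) :=
    hgauge.comp (LinearMap.toContinuousLinearMap e) one_pos fun x => by
      have hx : ‖e x‖ ^ 2 = ‖x.1‖ ^ 2 + ∑ i, x.2 i ^ 2 := he_norm x.1 x.2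
      have hsum : 0 ≤ ∑ i, x.2 i ^ 2 := sum_nonneg fun i _ => sq_nonneg _
      rw [one_mul, LinearMap.coe_toContinuousLinearMap', Prod.norm_def, sup_le_iff,
        pi_norm_le_iff_of_nonneg (norm_nonneg _)]
      refine ⟨(sq_le_sq₀ (norm_nonneg _) (norm_nonneg _)).1 (by linarith), fun i => ?_⟩
      have hi : x.2 i ^ 2 ≤ ∑ i, x.2 i ^ 2 :=
        single_le_sum (f := fun i => x.2 i ^ 2) (fun i _ => sq_nonneg _) (mem_univ i)
      refine abs_le_of_sq_le_sq (by nlinarith [sq_nonneg ‖x.1‖]) (norm_nonneg _)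
  obtain ⟨M, hM, hM_eq⟩ := IsEquivNorm.exists_lintegral_pi one_ne_zero m hN
  obtain ⟨c, hc⟩ := hausdorffMeasure_image_unitBall (V := EuclideanSpace ℝ (Fin n)) m
  have : Fact (Module.finrank ℝ P = 2) := ⟨hP⟩
  let o : Orientation ℝ P (Fin 2) := (Module.finBasisOfFinrankEq ℝ P hP).orientation
  let J := o.rightAngleRotation
  have hunit : ∀ p : P, ‖p‖ = 1 → sectVol n K p = c.toReal * (M (J p))⁻¹ := fun p hp => by
    have hp0 : p ≠ 0 := norm_ne_zero_iff.1 (by simp [hp])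
    have hJ : ‖J p‖ = 1 := by simp [hp]
    let L : ℝ × (Fin m → ℝ) →ₗ[ℝ] EuclideanSpace ℝ (Fin n) :=
      e ∘ₗ ((LinearMap.toSpanSingleton ℝ P (J p)).prodMap LinearMap.id)
    have hL : ∀ x, L x = e (x.1 • J p, x.2) := fun x => rfl
    have hL_norm : ∀ x, ‖L x‖ ^ 2 = x.1 ^ 2 + ∑ i, x.2 i ^ 2 := fun x => by
      rw [hL, he_norm, norm_smul, hJ, mul_one, Real.norm_eq_abs, sq_abs]
    have hNL : IsEquivNorm (fun x => gauge K (L x)) :=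
      hN.comp (((ContinuousLinearMap.toSpanSingleton ℝ (J p)).prodMap
        (ContinuousLinearMap.id ℝ (Fin m → ℝ)))) one_pos fun x => by
          simp [Prod.norm_def, norm_smul, hp]
    have hsection : K ∩ {y | inner ℝ y (p : EuclideanSpace ℝ (Fin n)) = (0 : ℝ)} =
        L '' {x | gauge K (L x) ≤ 1} := by
      ext y
      have hmem : ∀ y, gauge K y ≤ 1 ↔ y ∈ K := fun y => by
        rw [gauge_le_one_iff_mem_closure hK_conv hK0, hK_cpt.isClosed.closure_eq]
      simp only [Set.mem_inter_iff, Set.mem_ofPred_eq, Set.mem_image, hmem]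
      constructor
      · rintro ⟨hy, hyp⟩
        obtain ⟨⟨q, z⟩, rfl⟩ := he_surj y
        rw [he_inner] at hyp
        obtain ⟨a, rfl⟩ : ∃ a : ℝ, a • J p = q := by
          have hq := (o.basisRightAngleRotation p hp0).sum_repr q
          rw [Fin.sum_univ_two, o.coe_basisRightAngleRotation] at hq
          simp only [Matrix.cons_val_zero, Matrix.cons_val_one] at hq
          have h0 : (o.basisRightAngleRotation p hp0).repr q 0 = 0 := by
            rw [← hq] at hyp
            rw [inner_add_left, inner_smul_left, inner_smul_left, real_inner_self_eq_norm_sq, hp,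
              o.inner_rightAngleRotation_self] at hyp
            simpa using hyp
          rw [h0, zero_smul, zero_add] at hq
          exact ⟨_, hq⟩
        exact ⟨(a, z), hy, rfl⟩
      · rintro ⟨x, hx, rfl⟩
        refine ⟨hx, ?_⟩
        rw [hL, he_inner, inner_smul_left, o.inner_rightAngleRotation_self, mul_zero]
    have hMJ : 0 ≤ (M (J p))⁻¹ := inv_nonneg.2 (hM.nonneg _)
    have hJ0 : J p ≠ 0 := norm_ne_zero_iff.1 (by simp [hJ])
    have := hM_eq (J p) hJ0
    rw [sectVol, hsection, hn, hc L (gauge K) hL_norm hNL, ENNReal.toReal_mul]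
    simp only [hL, one_smul]
    rw [this, pow_one, ENNReal.toReal_ofReal hMJ]
  have hNK : ∀ p : P, NK n K p = c.toReal⁻¹ * M (J p) := fun p => by
    by_cases hp : p = 0
    · have h0 := hM.smul 0 0
      simp only [zero_smul, abs_zero, zero_mul] at h0
      simp [hp, NK, h0]
    obtain ⟨a, u, hu, rfl⟩ : ∃ (a : ℝ) (u : P), ‖u‖ = 1 ∧ a • u = p :=
      ⟨‖p‖, ‖p‖⁻¹ • p, norm_smul_inv_norm hp, smul_inv_smul₀ (norm_ne_zero_iff.2 hp) p⟩
    have hu0 : (u : EuclideanSpace ℝ (Fin n)) ≠ 0 := norm_ne_zero_iff.1 (by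
      rw [← Submodule.coe_norm, hu]
      exact one_ne_zero)
    rw [Submodule.coe_smul, NK_smul, NK, if_neg hu0, hunit u hu, ← Submodule.coe_norm, hu, one_div,
      mul_inv, inv_inv, map_smul, hM.smul]
    ring
  have hadd := hM.add_le (J p) (J q)
  rw [← map_add] at hadd
  rw [← Submodule.coe_add, hNK, hNK, hNK, ← mul_add]
  exact mul_le_mul_of_nonneg_left hadd (by positivity)

lemma NK_add_le {n : ℕ} {K : Set (EuclideanSpace ℝ (Fin n))}
    (hK_cpt : IsCompact K) (hK_conv : Convex ℝ K) (hK0 : K ∈ nhds 0) (hK_sym : K = -K)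
    (x y : EuclideanSpace ℝ (Fin n)) : NK n K (x + y) ≤ NK n K x + NK n K y := by
  by_cases hxy : LinearIndependent ℝ ![x, y]
  · have hP : Module.finrank ℝ (Submodule.span ℝ (Set.range ![x, y])) = 2 := by
      simpa using finrank_span_eq_card hxy
    exact NK_add_le_of_finrank_eq_two hK_cpt hK_conv hK0 hK_sym _ hP
      ⟨x, Submodule.subset_span ⟨0, rfl⟩⟩ ⟨y, Submodule.subset_span ⟨1, rfl⟩⟩
  by_cases hx : x = 0
  · simp [hx, NK]
  obtain ⟨a, rfl⟩ : ∃ a : ℝ, a • x = y := by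
    by_contra! h
    exact hxy ((LinearIndependent.pair_iff' hx).2 h)
  have hsum : x + a • x = (1 + a) • x := by rw [add_smul, one_smul]
  have habs : |1 + a| ≤ 1 + |a| := by simpa using abs_add_le 1 a
  rw [hsum, NK_smul, NK_smul]
  nlinarith [NK_nonneg (K := K) x]

/-- Busemann's theorem: for an origin-symmetric convex body `K`, the function `N_K`
is a norm: positively homogeneous, symmetric, vanishing only at `0`, and satisfying
the triangle inequality. -/
theorem busemann (n : ℕ) (K : Set (EuclideanSpace ℝ (Fin n)))
    (hK_cpt : IsCompact K) (hK_conv : Convex ℝ K)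
    (hK_int : (interior K).Nonempty) (hK_sym : K = -K) :
    (∀ (c : ℝ) (x : EuclideanSpace ℝ (Fin n)), 0 ≤ c →
        NK n K (c • x) = c * NK n K x) ∧
    (∀ x : EuclideanSpace ℝ (Fin n), NK n K (-x) = NK n K x) ∧
    (∀ x : EuclideanSpace ℝ (Fin n), NK n K x = 0 ↔ x = 0) ∧
    (∀ x y : EuclideanSpace ℝ (Fin n),
        NK n K (x + y) ≤ NK n K x + NK n K y) := by
  have hK0 := mem_nhds_zero_of_symmetric hK_conv hK_int hK_sym
  refine ⟨fun c x hc => ?_, fun x => ?_, fun x => ⟨fun h => ?_, fun h => if_pos h⟩,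
    NK_add_le hK_cpt hK_conv hK0 hK_sym⟩
  · rw [NK_smul, abs_of_nonneg hc]
  · simpa using NK_smul (K := K) (-1) x
  · by_contra hx
    rw [NK, if_neg hx] at h
    exact (div_pos (norm_pos_iff.2 hx) (sectVol_pos hK_cpt hK0 hx)).ne' h
end

section
/- Let X_1, …, X_n be independent symmetric real random variables, integrable to order p. For every n ≥ 1 and every real p ≥ 1, the function Φ(t_1, …, t_n) = log E|e^{t_1}X_1 + … + e^{t_n}X_n|^p is convex on ℝ^n. -/
open Finset MeasureTheory ProbabilityTheory

/-- A convex function that is even in each coordinate is monotone in the absolute values of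
the coordinates. -/
lemma ConvexOn.le_of_abs_le_of_even {ι : Type*} [Fintype ι] [DecidableEq ι]
    {f : (ι → ℝ) → ℝ} (hf : ConvexOn ℝ Set.univ f)
    (heven : ∀ x i, f (Function.update x i (-x i)) = f x)
    {x y : ι → ℝ} (hxy : ∀ i, |x i| ≤ y i) : f x ≤ f y := by
  have key : ∀ (w : ι → ℝ) (i : ι) (a : ℝ), |a| ≤ w i → f (Function.update w i a) ≤ f w := by
    intro w i a ha
    have hg : ConvexOn ℝ Set.univ (fun b : ℝ => f (Function.update w i b)) := by
      refine ⟨convex_univ, fun b _ c _ r s hr hs hrs => ?_⟩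
      have hupdate : Function.update w i (r • b + s • c)
          = r • Function.update w i b + s • Function.update w i c := by
        ext k
        by_cases hk : k = i
        · subst hk
          simp
        · simp [hk, ← add_mul, hrs]
      simp only [hupdate]
      exact hf.2 (Set.mem_univ _) (Set.mem_univ _) hr hs hrs
    have h := hg.le_max_of_mem_Icc (Set.mem_univ (-w i)) (Set.mem_univ (w i))
      (abs_le.mp ha)
    simpa [heven] using h
  have h : ∀ s : Finset ι, f (s.piecewise x y) ≤ f y := by
    intro s
    induction s using Finset.induction_on with
    | empty => simp
    | insert i s hi ih =>
      rw [Finset.piecewise_insert]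
      refine (key _ _ _ ?_).trans ih
      simpa [hi] using hxy i
  simpa using h Finset.univ

/-- Log-convexity in exponential coordinates of a convex function that is positively homogeneous
of degree `p` and even in each coordinate. -/
lemma ConvexOn.log_comp_exp_of_even_of_homogeneous {ι : Type*} [Fintype ι]
    [DecidableEq ι] {f : (ι → ℝ) → ℝ} {p : ℝ} (hp : 0 < p) (hf : ConvexOn ℝ Set.univ f)
    (hnonneg : ∀ x, 0 ≤ f x) (heven : ∀ x i, f (Function.update x i (-x i)) = f x)
    (hhom : ∀ c : ℝ, 0 ≤ c → ∀ x, f (c • x) = c ^ p * f x) :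
    ConvexOn ℝ Set.univ (fun t : ι → ℝ => Real.log (f fun i => Real.exp (t i))) := by
  by_cases hzero : ∃ t : ι → ℝ, f (fun i => Real.exp (t i)) = 0
  · obtain ⟨t, ht⟩ := hzero
    have hall : ∀ s : ι → ℝ, f (fun i => Real.exp (s i)) = 0 := by
      intro s
      set c : ℝ := ∑ i, Real.exp (s i - t i)
      refine le_antisymm ?_ (hnonneg _)
      have hle : f (fun i => Real.exp (s i)) ≤ f (c • fun i => Real.exp (t i)) := by
        refine hf.le_of_abs_le_of_even heven fun i => ?_
        have hi : Real.exp (s i - t i) ≤ c :=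
          Finset.single_le_sum (f := fun i => Real.exp (s i - t i))
            (fun k _ => (Real.exp_pos _).le) (Finset.mem_univ i)
        calc |Real.exp (s i)| = Real.exp (s i - t i) * Real.exp (t i) := by
              rw [abs_of_pos (Real.exp_pos _), ← Real.exp_add, sub_add_cancel]
          _ ≤ c * Real.exp (t i) := by gcongr
      rwa [hhom c (Finset.sum_nonneg fun k _ => (Real.exp_pos _).le), ht, mul_zero] at hle
    simpa [hall] using convexOn_const (0 : ℝ) (convex_univ (𝕜 := ℝ) (E := ι → ℝ))
  push Not at hzero
  have hpos : ∀ t : ι → ℝ, 0 < f (fun i => Real.exp (t i)) := fun t =>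
    (hnonneg _).lt_of_ne' (hzero t)
  refine ⟨convex_univ, fun t _ s _ a b ha hb hab => ?_⟩
  -- `A` and `B` are the logarithms of the gauges `f ^ (1 / p)` at the two endpoints.
  set A : ℝ := Real.log (f fun i => Real.exp (t i)) / p
  set B : ℝ := Real.log (f fun i => Real.exp (s i)) / p
  have hscale : ∀ u : ι → ℝ, ∀ c : ℝ, f (fun i => Real.exp (u i - c))
      = Real.exp (-(c * p)) * f (fun i => Real.exp (u i)) := by
    intro u c
    have h := hhom (Real.exp (-c)) (Real.exp_pos _).le (fun i => Real.exp (u i))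
    rw [← Real.exp_mul, neg_mul] at h
    rw [← h]
    congr 1
    ext i
    simp [← Real.exp_add, sub_eq_neg_add]
  have hnorm : ∀ u : ι → ℝ, f (fun i =>
      Real.exp (u i - Real.log (f fun i => Real.exp (u i)) / p)) = 1 := by
    intro u
    rw [hscale, div_mul_cancel₀ _ hp.ne', Real.exp_neg, Real.exp_log (hpos u),
      inv_mul_cancel₀ (hzero u)]
  have hle : f (fun i => Real.exp ((a • t + b • s) i - (a * A + b * B))) ≤ 1 := by
    calc f (fun i => Real.exp ((a • t + b • s) i - (a * A + b * B)))
        ≤ f (a • (fun i => Real.exp (t i - A)) + b • (fun i => Real.exp (s i - B))) := by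
          refine hf.le_of_abs_le_of_even heven fun i => ?_
          have h := convexOn_exp.2 (Set.mem_univ (t i - A)) (Set.mem_univ (s i - B)) ha hb hab
          rw [abs_of_pos (Real.exp_pos _)]
          have hexp : (a • t + b • s) i - (a * A + b * B)
              = a • (t i - A) + b • (s i - B) := by
            simp only [Pi.add_apply, Pi.smul_apply, smul_eq_mul]
            ring
          rw [hexp]
          exact h
      _ ≤ a • f (fun i => Real.exp (t i - A)) + b • f (fun i => Real.exp (s i - B)) :=
          hf.2 (Set.mem_univ _) (Set.mem_univ _) ha hb hab
      _ = 1 := by rw [hnorm t, hnorm s]; simpa using hab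
  rw [hscale] at hle
  have hlog := Real.log_le_log (mul_pos (Real.exp_pos _) (hpos _)) hle
  rw [Real.log_mul (Real.exp_pos _).ne' (hzero _), Real.log_exp, Real.log_one] at hlog
  have hAp : A * p = Real.log (f fun i => Real.exp (t i)) := div_mul_cancel₀ _ hp.ne'
  have hBp : B * p = Real.log (f fun i => Real.exp (s i)) := div_mul_cancel₀ _ hp.ne'
  simp only [← hAp, ← hBp, smul_eq_mul]
  linarith

/-- The `p`-th absolute moment of a linear combination is convex in the coefficients. -/
lemma convexOn_integral_abs_sum_rpow {Ω ι : Type*} [MeasurableSpace Ω] {μ : Measure Ω}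
    [Fintype ι] {p : ℝ} (hp : 1 ≤ p) {X : ι → Ω → ℝ}
    (hint : ∀ i, MemLp (X i) (ENNReal.ofReal p) μ) :
    ConvexOn ℝ Set.univ (fun x : ι → ℝ => ∫ ω, |∑ j, x j * X j ω| ^ p ∂μ) := by
  have hp0 : 0 < p := zero_lt_one.trans_le hp
  have hintegrable : ∀ x : ι → ℝ, Integrable (fun ω => |∑ j, x j * X j ω| ^ p) μ := by
    intro x
    have h : MemLp (fun ω => ∑ j, x j * X j ω) (ENNReal.ofReal p) μ :=
      memLp_finsetSum _ fun j _ => (hint j).const_mul (x j)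
    simpa [ENNReal.toReal_ofReal hp0.le] using
      h.integrable_norm_rpow (by simpa using hp0) ENNReal.ofReal_ne_top
  refine ⟨convex_univ, fun x _ y _ a b ha hb hab => ?_⟩
  simp only [smul_eq_mul]
  rw [← integral_const_mul, ← integral_const_mul,
    ← integral_add ((hintegrable x).const_mul a) ((hintegrable y).const_mul b)]
  refine integral_mono (hintegrable _)
    (((hintegrable x).const_mul a).add ((hintegrable y).const_mul b)) fun ω => ?_
  have hsum : ∑ j, (a • x + b • y) j * X j ω
      = a * ∑ j, x j * X j ω + b * ∑ j, y j * X j ω := by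
    simp [Finset.mul_sum, ← Finset.sum_add_distrib, add_mul, mul_assoc]
  calc |∑ j, (a • x + b • y) j * X j ω| ^ p
      ≤ (a * |∑ j, x j * X j ω| + b * |∑ j, y j * X j ω|) ^ p := by
        rw [hsum]
        gcongr
        refine (abs_add_le _ _).trans_eq ?_
        rw [abs_mul, abs_mul, abs_of_nonneg ha, abs_of_nonneg hb]
    _ ≤ a * |∑ j, x j * X j ω| ^ p + b * |∑ j, y j * X j ω| ^ p :=
        (convexOn_rpow hp).2 (Set.mem_Ici.mpr (abs_nonneg _)) (Set.mem_Ici.mpr (abs_nonneg _)) ha hb hab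

/-- Flipping the sign of one coordinate preserves the joint law of independent symmetric
random variables. -/
lemma ProbabilityTheory.iIndepFun.identDistrib_update_neg {Ω ι : Type*} [MeasurableSpace Ω]
    {μ : Measure Ω} [IsProbabilityMeasure μ] [Fintype ι] [DecidableEq ι] {X : ι → Ω → ℝ}
    (hindep : iIndepFun X μ) (hmeas : ∀ i, Measurable (X i)) (i : ι)
    (hsymm : μ.map (fun ω => -X i ω) = μ.map (X i)) :
    IdentDistrib (fun ω => Function.update (fun j => X j ω) i (-X i ω))
      (fun ω j => X j ω) μ μ := by
  set Y : ι → Ω → ℝ := Function.update X i (fun ω => -X i ω) with hY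
  have hYX : (fun ω => Function.update (fun j => X j ω) i (-X i ω)) = fun ω j => Y j ω := by
    ext ω j
    by_cases hj : j = i
    · subst hj
      simp [hY]
    · simp [hY, hj]
  have hYmeas : ∀ j, Measurable (Y j) := by
    intro j
    by_cases hj : j = i
    · subst hj
      rw [hY, Function.update_self]
      exact (hmeas j).neg
    · simpa [hY, hj] using hmeas j
  have hYmap : ∀ j, μ.map (Y j) = μ.map (X j) := by
    intro j
    by_cases hj : j = i
    · subst hj
      simpa [hY] using hsymm
    · simp [hY, hj]
  have hYindep : iIndepFun Y μ := by
    have hg : ∀ j, Measurable (if j = i then (fun r : ℝ => -r) else id) := by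
      intro j
      split_ifs <;> fun_prop
    convert hindep.comp _ hg using 1
    ext j ω
    by_cases hj : j = i
    · subst hj
      simp [hY]
    · simp [hY, hj]
  rw [hYX]
  refine ⟨(measurable_pi_lambda _ hYmeas).aemeasurable,
    (measurable_pi_lambda _ hmeas).aemeasurable, ?_⟩
  rw [(iIndepFun_iff_map_fun_eq_pi_map fun j => (hYmeas j).aemeasurable).mp hYindep,
    (iIndepFun_iff_map_fun_eq_pi_map fun j => (hmeas j).aemeasurable).mp hindep]
  simp only [hYmap]

/-- Let `X_1, …, X_n` be independent symmetric random variables, integrable to order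
`p ≥ 1`. Then `Φ(t) = log E|e^{t_1}X_1 + … + e^{t_n}X_n|^p` is convex on `ℝ^n`. -/
theorem log_moment_symmetric_convex {Ω : Type*} [MeasureSpace Ω]
    [IsProbabilityMeasure (ℙ : Measure Ω)]
    (n : ℕ) (hn : 1 ≤ n) (p : ℝ) (hp : 1 ≤ p)
    (X : Fin n → Ω → ℝ)
    (hmeas : ∀ i, Measurable (X i))
    (hindep : iIndepFun X ℙ)
    (hsymm : ∀ i, Measure.map (fun ω => -X i ω) ℙ = Measure.map (X i) ℙ)
    (hint : ∀ i, MemLp (X i) (ENNReal.ofReal p) ℙ) :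
    ConvexOn ℝ Set.univ (fun t : Fin n → ℝ =>
      Real.log (∫ ω, |∑ j, Real.exp (t j) * X j ω| ^ p)) := by
  refine (convexOn_integral_abs_sum_rpow hp hint).log_comp_exp_of_even_of_homogeneous
    (zero_lt_one.trans_le hp) (fun x => integral_nonneg fun ω => by positivity) ?_ ?_
  · intro x i
    have hident := (hindep.identDistrib_update_neg hmeas i (hsymm i)).comp
      (u := fun z : Fin n → ℝ => |∑ j, x j * z j| ^ p) (by fun_prop)
    refine Eq.trans ?_ hident.integral_eq
    congr 1
    ext ω
    simp only [Function.comp_apply]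
    congr 2
    refine Finset.sum_congr rfl fun j _ => ?_
    by_cases hj : j = i
    · subst hj
      simp
    · simp [hj]
  · intro c hc x
    rw [← integral_const_mul]
    congr 1
    ext ω
    have hsum : ∑ j, (c • x) j * X j ω = c * ∑ j, x j * X j ω := by
      simp [Finset.mul_sum, mul_assoc]
    rw [hsum, abs_mul, abs_of_nonneg hc, Real.mul_rpow hc (abs_nonneg _)]
end
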